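/- arXiv:2107.00775 — 4 statements merged into one kernel-verified Lean document; each statement's English description precedes it below -/
import Mathlib

section
/- Let A be a 1-perfect finite-dimensional unital associative algebra over an algebraically closed field F of characteristic p with p ≠ 2 and p ≠ 3, let A' be a subalgebra of A, and let B' be a bar-minimal Jordan-Lie inner ideal of the Lie algebra A'^(-) (bar-minimality taken with respect to the image in A'/rad A'). Then there exists a strict orthogonal idempotent pair (e,f) in A such that B' ⊆ eAf. -/
namespace Paper

variable (F A : Type*) [Field F] [Ring A] [Algebra F A]

/-- The derived series `A⁽ᵏ⁾` of the Lie algebra `A⁽⁻⁾` (as subspaces of `A`). -/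
def derivedSeries : ℕ → Submodule F A
  | 0 => ⊤
  | (k+1) => Submodule.span F
      {z : A | ∃ x ∈ derivedSeries k, ∃ y ∈ derivedSeries k, z = ⁅x, y⁆}

variable {F A}

/-- `B` is an inner ideal of the Lie algebra given by the subspace `L` of `A⁽⁻⁾`. -/
def IsInnerIdeal (L B : Submodule F A) : Prop :=
  B ≤ L ∧ ∀ b ∈ B, ∀ b' ∈ B, ∀ x ∈ L, ⁅b, ⁅b', x⁆⁆ ∈ B

/-- `B` is a Jordan-Lie inner ideal of `L`. -/
def IsJordanLie (L B : Submodule F A) : Prop :=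
  IsInnerIdeal L B ∧ ∀ b ∈ B, ∀ b' ∈ B, b * b' = 0

/-- Jacobson radical of `A` as an `F`-subspace. -/
noncomputable def radical : Submodule F A :=
  (Ideal.jacobson (⊥ : Ideal A)).restrictScalars F

/-- The Jacobson radical of a subalgebra `A'`, as a subset of `A`. -/
def subalgRad (A' : Subalgebra F A) : Set A :=
  Subtype.val '' ((Ideal.jacobson (⊥ : Ideal A')) : Set A')

/-- `c` represents a central idempotent of the quotient of the
(sub)algebra with carrier `S` by the ideal with carrier `ρ`. -/
def IsCentralIdempotentMod (S ρ : Set A) (c : A) : Prop :=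
  c ∈ S ∧ (∀ a ∈ S, c * a - a * c ∈ ρ) ∧ c * c - c ∈ ρ

/-- `c` represents a primitive central idempotent of the quotient mod `ρ`. -/
def IsPrimitiveCentralIdempotentMod (S ρ : Set A) (c : A) : Prop :=
  IsCentralIdempotentMod S ρ c ∧ c ∉ ρ ∧
    ¬ ∃ c₁ c₂ : A, IsCentralIdempotentMod S ρ c₁ ∧ IsCentralIdempotentMod S ρ c₂ ∧
      c₁ ∉ ρ ∧ c₂ ∉ ρ ∧ c₁ * c₂ ∈ ρ ∧ c₂ * c₁ ∈ ρ ∧ c - (c₁ + c₂) ∈ ρ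

/-- The idempotent pair `(e, f)` is strict w.r.t. the quotient mod `ρ`:
for every primitive central idempotent `c` of the quotient, `c·ē = 0 ↔ c·f̄ = 0`. -/
def IsStrictPairMod (S ρ : Set A) (e f : A) : Prop :=
  ∀ c : A, IsPrimitiveCentralIdempotentMod S ρ c → (c * e ∈ ρ ↔ c * f ∈ ρ)

/-- `(e,f)` is a strict idempotent pair of `A` (strictness w.r.t. `A/rad A`). -/
def IsStrictPair (e f : A) : Prop :=
  e * e = e ∧ f * f = f ∧
    IsStrictPairMod Set.univ ((Ideal.jacobson (⊥ : Ideal A)) : Set A) e f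

/-- `J` is a two-sided ideal of the (possibly non-unital) algebra `P`. -/
def IsTwoSidedIdealIn (P J : Submodule F A) : Prop :=
  J ≤ P ∧ ∀ p ∈ P, ∀ x ∈ J, p * x ∈ J ∧ x * p ∈ J

/-- The algebra with carrier `P` is 1-perfect: it has no two-sided ideals of
codimension 1. -/
def IsOnePerfect (P : Submodule F A) : Prop :=
  ¬ ∃ J : Submodule F A, IsTwoSidedIdealIn P J ∧
      Module.finrank F P = Module.finrank F J + 1

/-- `N` is a nil two-sided ideal with von Neumann regular quotient. -/
structure IsNilWithRegularQuotient (N : Submodule F A) : Prop where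
  mul_left : ∀ a, ∀ n ∈ N, a * n ∈ N
  mul_right : ∀ a, ∀ n ∈ N, n * a ∈ N
  nil : ∀ n ∈ N, IsNilpotent n
  regular : ∀ d, ∃ x, d - d * x * d ∈ N

namespace IsNilWithRegularQuotient

open Polynomial in
theorem exists_idempotent {N : Submodule F A} (hN : IsNilWithRegularQuotient N) {a : A}
    (ha : a - a * a ∈ N) :
    ∃ q, a * q * (a * q) = a * q ∧ a * q - a ∈ N := by
  obtain ⟨n, hn⟩ := hN.nil _ ha
  have hn' : (a - a * a) ^ (n + 1) = 0 := by rw [pow_succ, hn, zero_mul]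
  have hidem := isIdempotentElem_one_sub_one_sub_pow_pow a (n + 1) (by rw [pow_two]; exact hn')
  let P : F[X] := 1 - (1 - X ^ (n + 1)) ^ (n + 1)
  have hX : X ∣ P := by
    rw [X_dvd_iff, coeff_zero_eq_eval_zero]
    simp [P]
  have hPX : X * (1 - X) ∣ P - X := by
    refine IsCoprime.mul_dvd ⟨1, 1, by ring⟩ (hX.sub dvd_rfl) ?_
    rw [← neg_dvd, neg_sub, ← C_1, dvd_iff_isRoot]
    simp [P]
  obtain ⟨Q, hQ⟩ := hX
  obtain ⟨S, hS⟩ := hPX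
  have hP : aeval a P = 1 - (1 - a ^ (n + 1)) ^ (n + 1) := by simp [P]
  have hq : a * aeval a Q = aeval a P := by rw [hQ]; simp
  refine ⟨aeval a Q, ?_, ?_⟩
  · rw [hq, hP]
    exact hidem
  · have h : aeval a P - a = (a - a * a) * aeval a S := by
      have := congrArg (aeval a) hS
      simpa [mul_sub] using this
    rw [hq, h]
    exact hN.mul_right _ _ ha

theorem exists_regular {N : Submodule F A} (hN : IsNilWithRegularQuotient N) (d : A) :
    ∃ t z, d - d * t * d ∈ N ∧ d * t * d * z * (d * t * d) = d * t * d := by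
  obtain ⟨x, hx⟩ := hN.regular d
  obtain ⟨q, hq, hqN⟩ := hN.exists_idempotent (a := d * x) (by
    have := hN.mul_right x _ hx
    rwa [sub_mul, mul_assoc (d * x)] at this)
  refine ⟨x * q, x * q, ?_, ?_⟩
  · have h : d - d * (x * q) * d = (d - d * x * d) - (d * x * q - d * x) * d := by noncomm_ring
    rw [h]
    exact N.sub_mem hx (hN.mul_right _ _ hqN)
  · have hq' : d * (x * q) * (d * (x * q)) = d * (x * q) := by simpa only [mul_assoc] using hq
    calc d * (x * q) * d * (x * q) * (d * (x * q) * d)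
        = d * (x * q) * (d * (x * q)) * (d * (x * q)) * d := by simp only [mul_assoc]
      _ = _ := by rw [hq', hq']

theorem op {N : Submodule F A} (hN : IsNilWithRegularQuotient N) :
    IsNilWithRegularQuotient (N.comap (MulOpposite.opLinearEquiv F).symm.toLinearMap) where
  mul_left a n hn := hN.mul_right a.unop n.unop hn
  mul_right a n hn := hN.mul_left a.unop n.unop hn
  nil n hn := by
    obtain ⟨k, hk⟩ := hN.nil n.unop hn
    exact ⟨k, MulOpposite.unop_injective (by simpa using hk)⟩
  regular d := by
    obtain ⟨x, hx⟩ := hN.regular d.unop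
    exact ⟨MulOpposite.op x, by simpa [mul_assoc] using hx⟩

variable [FiniteDimensional F A]

theorem exists_left_unit_of_right_ideal {N : Submodule F A} (hN : IsNilWithRegularQuotient N)
    (I : Submodule F A) (hI : ∀ i ∈ I, ∀ a, i * a ∈ I) :
    ∃ e ∈ I, e * e = e ∧ ∀ i ∈ I, i - e * i ∈ N := by
  obtain ⟨_, ⟨e, ⟨heI, he⟩, rfl⟩, hmax⟩ := set_has_maximal_iff_noetherian.mpr
    (inferInstance : IsNoetherian F A)
    ((fun e : A => LinearMap.range (LinearMap.mulLeft F e)) '' {e | e ∈ I ∧ e * e = e})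
    ⟨_, 0, ⟨I.zero_mem, zero_mul 0⟩, rfl⟩
  refine ⟨e, heI, he, fun i hi => ?_⟩
  by_contra hiN
  obtain ⟨t, z, hd, hz⟩ := hN.exists_regular (i - e * i)
  set d := i - e * i with hd_def
  set d' := d * t * d with hd'
  have hdI : d ∈ I := I.sub_mem hi (hI _ heI _)
  have hd'I : d' ∈ I := hI _ (hI _ hdI _) _
  have hed : e * d = 0 := by rw [hd_def, mul_sub, ← mul_assoc, he, sub_self]
  have hed' : e * d' = 0 := by rw [hd', ← mul_assoc, ← mul_assoc, hed, zero_mul, zero_mul]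
  have hd'0 : d' ≠ 0 := fun h => hiN (by rwa [h, sub_zero] at hd)
  have hz' : d' * (z * d') = d' := by rw [← mul_assoc, hz]
  have hz'' (w : A) : d' * (z * (d' * w)) = d' * w := by rw [← mul_assoc z, ← mul_assoc, hz']
  have hed'' (w : A) : e * (d' * w) = 0 := by rw [← mul_assoc, hed', zero_mul]
  have he'' (w : A) : e * (e * w) = e * w := by rw [← mul_assoc, he]
  let h := d' * z * (1 - e)
  refine hmax _ ⟨e + h, ⟨I.add_mem heI (hI _ (hI _ hd'I _) _), ?_⟩, rfl⟩
    (lt_of_le_of_ne ?_ fun heq => ?_)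
  · simp only [h, mul_add, add_mul, mul_sub, sub_mul, mul_one, mul_assoc, he, hed'', hz'']
    simp
  · rintro _ ⟨w, rfl⟩
    refine ⟨e * w, ?_⟩
    simp [h, add_mul, mul_sub, sub_mul, mul_assoc, he'']
  · have : d' ∈ LinearMap.range (LinearMap.mulLeft F e) := by
      beta_reduce at heq
      rw [heq]
      refine ⟨d', ?_⟩
      simp [h, add_mul, mul_sub, sub_mul, mul_assoc, hed', hz']
    obtain ⟨w, hw⟩ := this
    apply hd'0
    have hw' : e * w = d' := hw
    rw [← hw', ← he, mul_assoc, hw', hed']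

theorem exists_right_unit_of_left_ideal {N : Submodule F A} (hN : IsNilWithRegularQuotient N)
    (I : Submodule F A) (hI : ∀ i ∈ I, ∀ a, a * i ∈ I) :
    ∃ f ∈ I, f * f = f ∧ ∀ i ∈ I, i - i * f ∈ N := by
  obtain ⟨f, hfI, hf, h⟩ := hN.op.exists_left_unit_of_right_ideal
    (I.comap (MulOpposite.opLinearEquiv F).symm.toLinearMap) (fun i hi a => hI i.unop hi a.unop)
  exact ⟨f.unop, hfI, congrArg MulOpposite.unop hf, fun i hi => h (MulOpposite.op i) hi⟩

end IsNilWithRegularQuotient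

section JordanInner

variable {B : Submodule F A}

/-- The two-sided Peirce `(0,0)` component of a square-zero Jordan inner ideal vanishes modulo a
nil ideal with regular quotient, for a suitable regular element. -/
theorem exists_complete_regular [FiniteDimensional F A] {N : Submodule F A}
    (hN : IsNilWithRegularQuotient N)
    (hJ : ∀ b ∈ B, ∀ b' ∈ B, ∀ x, b * x * b' + b' * x * b ∈ B)
    (hU : ∀ b ∈ B, ∀ x, b * x * b ∈ B) :
    ∃ b ∈ B, ∃ x, b * x * b = b ∧ ∀ b' ∈ B, (1 - b * x) * b' * (1 - x * b) ∈ N := by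
  obtain ⟨_, ⟨b, ⟨hbB, x, hbx⟩, rfl⟩, hmax⟩ := set_has_maximal_iff_noetherian.mpr
    (inferInstance : IsNoetherian F A)
    ((fun b : A => LinearMap.range (LinearMap.mulLeft F b)) '' {b | b ∈ B ∧ ∃ x, b * x * b = b})
    ⟨_, 0, ⟨B.zero_mem, 0, by simp⟩, rfl⟩
  refine ⟨b, hbB, x, hbx, fun b' hb' => ?_⟩
  by_contra hdN
  have h1 : b * (x * b) = b := by rw [← mul_assoc, hbx]
  have h2 (w : A) : b * (x * (b * w)) = b * w := by rw [← mul_assoc x, ← mul_assoc, h1]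
  have hdB : (1 - b * x) * b' * (1 - x * b) ∈ B := by
    have h : (1 - b * x) * b' * (1 - x * b)
        = b' - (b * x * b' + b' * x * b) + b * (x * b' * x) * b := by noncomm_ring
    rw [h]
    exact B.add_mem (B.sub_mem hb' (hJ b hbB b' hb' x)) (hU b hbB _)
  obtain ⟨t, z, hd, hz⟩ := hN.exists_regular ((1 - b * x) * b' * (1 - x * b))
  set d := (1 - b * x) * b' * (1 - x * b) with hd_def
  have hl : b * (x * d) = 0 := by
    simp only [hd_def, sub_mul, mul_sub, one_mul, mul_one, mul_assoc, h2]
    simp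
  have hr : d * (x * b) = 0 := by
    simp only [hd_def, sub_mul, mul_sub, one_mul, mul_one, mul_assoc, h1]
    simp
  set d' := d * t * d with hd'
  have hl' : b * (x * d') = 0 := by
    rw [hd', mul_assoc, ← mul_assoc x, ← mul_assoc, hl, zero_mul]
  have hr' : d' * (x * b) = 0 := by rw [hd', mul_assoc, hr, mul_zero]
  have hl'' (w : A) : b * (x * (d' * w)) = 0 := by rw [← mul_assoc x, ← mul_assoc, hl', zero_mul]
  have hr'' (w : A) : d' * (x * (b * w)) = 0 := by rw [← mul_assoc x, ← mul_assoc, hr', zero_mul]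
  have hd'0 : d' ≠ 0 := fun h => hdN (by rwa [h, sub_zero] at hd)
  have hz' : d' * (z * d') = d' := by rw [← mul_assoc, hz]
  refine hmax _ ⟨b + d', ⟨B.add_mem hbB (hU d hdB t), x * b * x + (1 - x * b) * z * (1 - b * x),
    ?_⟩, rfl⟩ (lt_of_le_of_ne ?_ fun heq => ?_)
  · simp only [add_mul, mul_add, sub_mul, mul_sub, one_mul, mul_one, mul_assoc, h1, h2, hl', hr'',
      hz']
    simp
  · rintro _ ⟨w, rfl⟩
    refine ⟨x * b * w, ?_⟩
    simp [add_mul, mul_assoc, h2, hr'']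
  · have : d' ∈ LinearMap.range (LinearMap.mulLeft F b) := by
      beta_reduce at heq
      rw [heq]
      refine ⟨1 - x * b, ?_⟩
      simp [add_mul, mul_sub, h1, hr']
    obtain ⟨w, hw⟩ := this
    apply hd'0
    have hw' : b * w = d' := hw
    rw [← hw', ← h2, hw', hl']

/-- A square-zero Jordan inner ideal contains an associative inner ideal with the same image. -/
theorem exists_associative_core [FiniteDimensional F A] {N : Submodule F A}
    (hN : IsNilWithRegularQuotient N)
    (hJ : ∀ b ∈ B, ∀ b' ∈ B, ∀ x, b * x * b' + b' * x * b ∈ B)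
    (hU : ∀ b ∈ B, ∀ x, b * x * b ∈ B) :
    ∃ C ≤ B, C * ⊤ * C ≤ C ∧ ∀ b ∈ B, ∃ c ∈ C, b - c ∈ N := by
  obtain ⟨b, hbB, x, hbx, h0⟩ := exists_complete_regular hN hJ hU
  have h1 : b * (x * b) = b := by rw [← mul_assoc, hbx]
  have h2 (w : A) : b * (x * (b * w)) = b * w := by rw [← mul_assoc x, ← mul_assoc, h1]
  let P : Submodule F A := B ⊓ LinearMap.eqLocus (LinearMap.mulLeft F (b * x)) LinearMap.id
  let Q : Submodule F A := B ⊓ LinearMap.eqLocus (LinearMap.mulRight F (x * b)) LinearMap.id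
  have hP (p : A) : p ∈ P ↔ p ∈ B ∧ b * x * p = p := Iff.rfl
  have hQ (q : A) : q ∈ Q ↔ q ∈ B ∧ q * (x * b) = q := Iff.rfl
  have hbP : b ∈ P := (hP b).2 ⟨hbB, hbx⟩
  have hbQ : b ∈ Q := (hQ b).2 ⟨hbB, h1⟩
  have hPC {p : A} (hp : p ∈ P) : p ∈ Q * ⊤ * P := by
    rw [← ((hP p).1 hp).2]
    exact Submodule.mul_mem_mul (Submodule.mul_mem_mul hbQ trivial) hp
  have hQC {q : A} (hq : q ∈ Q) : q ∈ Q * ⊤ * P := by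
    rw [← ((hQ q).1 hq).2, ← mul_assoc]
    exact Submodule.mul_mem_mul (Submodule.mul_mem_mul hq trivial) hbP
  refine ⟨Q * ⊤ * P, ?_, ?_, fun b' hb' => ?_⟩
  · rw [mul_assoc, Submodule.mul_le]
    intro q hq m hm
    induction hm using Submodule.mul_induction_on' with
    | add m _ m' _ h h' => rw [mul_add]; exact B.add_mem h h'
    | mem_mul_mem a _ p hp =>
      obtain ⟨hqB, hq⟩ := (hQ q).1 hq
      obtain ⟨hpB, hp⟩ := (hP p).1 hp
      have hpq : p * a * q = b * (x * (p * a * q) * x) * b := by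
        conv_lhs => rw [← hp, ← hq]
        simp only [mul_assoc]
      have h := B.sub_mem (hJ q hqB p hpB a) (hpq ▸ hU b hbB _)
      rwa [add_sub_cancel_right, mul_assoc] at h
  · calc Q * ⊤ * P * ⊤ * (Q * ⊤ * P) = Q * (⊤ * P * ⊤ * Q * ⊤) * P := by simp only [mul_assoc]
      _ ≤ Q * ⊤ * P := mul_le_mul' (mul_le_mul' le_rfl le_top) le_rfl
  · set u := b * x * b' * (1 - x * b) with hu
    set v := (1 - b * x) * b' * (x * b) with hv
    set w := b * x * b' + b' * x * b - 2 • (b * (x * b' * x) * b) with hw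
    have hwB : w ∈ B := B.sub_mem (hJ b hbB b' hb' x) (B.nsmul_mem (hU b hbB _) 2)
    have hwr : w * (1 - x * b) = u := by
      simp only [hw, hu, sub_mul, add_mul, mul_sub, mul_one, mul_assoc, h1, smul_mul_assoc]
      abel
    have hwl : (1 - b * x) * w = v := by
      simp only [hw, hv, sub_mul, mul_add, mul_sub, one_mul, mul_assoc, h2, mul_smul_comm]
      abel
    have hwu : b * x * w = u := by
      simp only [hw, hu, mul_add, mul_sub, mul_one, mul_assoc, h2, mul_smul_comm]
      abel
    have hwv : w * (x * b) = v := by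
      simp only [hw, hv, sub_mul, add_mul, one_mul, mul_assoc, h1, smul_mul_assoc]
      abel
    obtain ⟨y, hy⟩ := hN.regular u
    obtain ⟨z, hz⟩ := hN.regular v
    have hp : u * y * u ∈ P := by
      refine (hP _).2 ⟨?_, ?_⟩
      · have h : u * y * u = w * ((1 - x * b) * y * (b * x)) * w := by
          conv_lhs => lhs; rw [← hwr]
          conv_lhs => rw [← hwu]
          simp only [mul_assoc]
        rw [h]
        exact hU w hwB _
      · simp only [hu, mul_assoc, h2]
    have hq : v * z * v ∈ Q := by
      refine (hQ _).2 ⟨?_, ?_⟩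
      · have h : v * z * v = w * ((x * b) * z * (1 - b * x)) * w := by
          conv_lhs => lhs; rw [← hwv]
          conv_lhs => rw [← hwl]
          simp only [mul_assoc]
        rw [h]
        exact hU w hwB _
      · simp only [hv, mul_assoc, h1]
    have hb : b * (x * b' * x) * b ∈ Q * ⊤ * P :=
      Submodule.mul_mem_mul (Submodule.mul_mem_mul hbQ trivial) hbP
    refine ⟨b * (x * b' * x) * b + u * y * u + v * z * v,
      Submodule.add_mem _ (Submodule.add_mem _ hb (hPC hp)) (hQC hq), ?_⟩
    have h : b' - (b * (x * b' * x) * b + u * y * u + v * z * v)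
        = (1 - b * x) * b' * (1 - x * b) + (u - u * y * u) + (v - v * z * v) := by
      have h' : b' - b * (x * b' * x) * b = (1 - b * x) * b' * (1 - x * b) + u + v := by
        simp only [hu, hv]
        noncomm_ring
      rw [← sub_sub, ← sub_sub, h']
      abel
    rw [h]
    exact N.add_mem (N.add_mem (h0 b' hb') hy) hz

/-- A bar-minimal square-zero Jordan inner ideal is contained in `eAf` for orthogonal idempotents
`e`, `f` generating the same two-sided ideal. -/
theorem exists_idempotent_pair [FiniteDimensional F A] {N : Submodule F A}
    (hN : IsNilWithRegularQuotient N)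
    (hB : ∀ b ∈ B, ∀ b' ∈ B, b * b' = 0)
    (hJ : ∀ b ∈ B, ∀ b' ∈ B, ∀ x, b * x * b' + b' * x * b ∈ B)
    (hU : ∀ b ∈ B, ∀ x, b * x * b ∈ B)
    (hmin : ∀ C ≤ B, C * ⊤ * C ≤ C → (∀ b ∈ B, ∃ c ∈ C, b - c ∈ N) → C = B) :
    ∃ e f : A, e * e = e ∧ f * f = f ∧ e * f = 0 ∧ f * e = 0 ∧ (∀ b ∈ B, b = e * b * f) ∧
      ∀ K : Submodule F A, (∀ k ∈ K, ∀ a, a * k ∈ K ∧ k * a ∈ K) → (e ∈ K ↔ f ∈ K) := by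
  obtain ⟨C, hCB, hC, hCN⟩ := exists_associative_core hN hJ hU
  obtain rfl := hmin C hCB hC hCN
  have hassoc {b c : A} (hb : b ∈ C) (a : A) (hc : c ∈ C) : b * a * c ∈ C :=
    hC (Submodule.mul_mem_mul (Submodule.mul_mem_mul hb trivial) hc)
  have htop : (⊤ : Submodule F A) * ⊤ ≤ ⊤ := le_top
  have hself {b : A} (hb : b ∈ C) : b ∈ C * (⊤ : Submodule F A) := by
    simpa using Submodule.mul_mem_mul hb (Submodule.mem_top (x := (1 : A)))
  have hself' {b : A} (hb : b ∈ C) : b ∈ (⊤ : Submodule F A) * C := by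
    simpa using Submodule.mul_mem_mul (Submodule.mem_top (x := (1 : A))) hb
  obtain ⟨e, heI, he, heN⟩ := hN.exists_left_unit_of_right_ideal (C * ⊤) (fun i hi a => by
    have h := Submodule.mul_mem_mul hi (Submodule.mem_top (R := F) (x := a))
    rw [mul_assoc] at h
    exact mul_le_mul' le_rfl htop h)
  obtain ⟨f, hfI, hf, hfN⟩ := hN.exists_right_unit_of_left_ideal (⊤ * C) (fun i hi a => by
    have h := Submodule.mul_mem_mul (Submodule.mem_top (R := F) (x := a)) hi
    rw [← mul_assoc] at h
    exact mul_le_mul' htop le_rfl h)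
  have hCC : C * C = ⊥ := by
    rw [eq_bot_iff, Submodule.mul_le]
    exact fun b hb c hc => (Submodule.mem_bot F).2 (hB b hb c hc)
  have hfe : f * e = 0 := by
    have h := Submodule.mul_mem_mul hfI heI
    rw [mul_assoc, ← mul_assoc C, hCC] at h
    simpa using h
  have hfb {b : A} (hb : b ∈ C) : f * b = 0 := by
    have h := Submodule.mul_mem_mul hfI hb
    rw [mul_assoc, hCC] at h
    simpa using h
  have heb {b : A} (hb : b ∈ C) : e * b ∈ C := hC (Submodule.mul_mem_mul heI hb)
  have hbf {b : A} (hb : b ∈ C) : b * f ∈ C := by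
    have h := Submodule.mul_mem_mul hb hfI
    rw [← mul_assoc] at h
    exact hC h
  have hD : C.map (LinearMap.mulLeft F e ∘ₗ LinearMap.mulRight F f) = C := by
    refine hmin _ ?_ ?_ ?_
    · rintro _ ⟨b, hb, rfl⟩
      exact heb (hbf hb)
    · rw [mul_assoc, Submodule.mul_le]
      rintro _ ⟨b, hb, rfl⟩ m hm
      induction hm using Submodule.mul_induction_on' with
      | add m _ m' _ h h' => rw [mul_add]; exact Submodule.add_mem _ h h'
      | mem_mul_mem a _ c hc =>
        obtain ⟨c, hc, rfl⟩ := hc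
        exact ⟨b * (f * a * e) * c, hassoc hb _ hc, by simp [mul_assoc]⟩
    · intro b hb
      refine ⟨e * (b * f), ⟨b, hb, rfl⟩, ?_⟩
      have h : b - e * (b * f) = (b - e * b) + e * (b - b * f) := by noncomm_ring
      rw [h]
      exact N.add_mem (heN b (hself hb)) (hN.mul_left _ _ (hfN b (hself' hb)))
  have hbe {b : A} (hb : b ∈ C) : e * b = b := by
    rw [← hD] at hb
    obtain ⟨c, -, rfl⟩ := hb
    simp [← mul_assoc, he]
  have hbf' {b : A} (hb : b ∈ C) : b * f = b := by
    rw [← hD] at hb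
    obtain ⟨c, -, rfl⟩ := hb
    simp [mul_assoc, hf]
  have hbe' {b : A} (hb : b ∈ C) : (e - e * f) * b = b := by
    rw [sub_mul, mul_assoc, hfb hb, mul_zero, sub_zero, hbe hb]
  refine ⟨e - e * f, f, ?_, hf, ?_, ?_, fun b hb => by rw [hbe' hb, hbf' hb], fun K hK => ?_⟩
  · have h (w : A) : f * (e * w) = 0 := by rw [← mul_assoc, hfe, zero_mul]
    simp [mul_sub, sub_mul, mul_assoc, he, hfe, h, ← mul_assoc e e]
  · rw [sub_mul, mul_assoc, hf, sub_self]
  · rw [mul_sub, ← mul_assoc, hfe, zero_mul, sub_zero]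
  · constructor
    · intro h
      refine (?_ : ⊤ * C ≤ K) hfI
      rw [Submodule.mul_le]
      intro a _ b hb
      rw [← hbe' hb]
      exact (hK _ (hK _ h b).2 a).1
    · intro h
      have heK : e ∈ K := by
        refine (?_ : C * ⊤ ≤ K) heI
        rw [Submodule.mul_le]
        intro b hb a _
        rw [← hbf' hb]
        exact (hK _ (hK _ h b).1 a).2
      exact K.sub_mem heK (hK _ heK f).2

end JordanInner

theorem isNilWithRegularQuotient_jacobson [FiniteDimensional F A] :
    IsNilWithRegularQuotient
      ((Ideal.jacobson (⊥ : Ideal A)).restrictScalars F) := by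
  have : IsArtinianRing A := IsArtinianRing.of_finite F A
  rw [Ideal.jacobson_bot]
  refine ⟨fun a n hn => Ideal.mul_mem_left _ a hn, fun a n hn => Ideal.mul_mem_right a _ hn,
    fun n hn => ?_, fun d => ?_⟩
  · obtain ⟨k, hk⟩ := IsSemiprimaryRing.isNilpotent (R := A)
    refine ⟨k, ?_⟩
    have h := Ideal.pow_mem_pow hn k
    rw [hk] at h
    simpa using h
  · obtain ⟨e, he, hspan⟩ := IsSemisimpleRing.ideal_eq_span_idempotent
      (Ideal.span {Ideal.Quotient.mk (Ring.jacobson A) d})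
    obtain ⟨x, hx⟩ := Ideal.mem_span_singleton'.1
      (hspan ▸ Ideal.mem_span_singleton_self e : e ∈ Ideal.span {Ideal.Quotient.mk _ d})
    obtain ⟨y, hy⟩ := Ideal.mem_span_singleton'.1
      (hspan ▸ Ideal.mem_span_singleton_self (Ideal.Quotient.mk (Ring.jacobson A) d))
    obtain ⟨x, rfl⟩ := Ideal.Quotient.mk_surjective x
    refine ⟨x, ?_⟩
    rw [Submodule.restrictScalars_mem, ← Ideal.Quotient.eq, map_mul, map_mul, mul_assoc, hx, ← hy,
      mul_assoc, he]

theorem isStrictPairMod_jacobson {e f : A}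
    (h : ∀ K : Submodule F A, (∀ k ∈ K, ∀ a, a * k ∈ K ∧ k * a ∈ K) → (e ∈ K ↔ f ∈ K)) :
    IsStrictPairMod Set.univ ((Ideal.jacobson (⊥ : Ideal A)) : Set A) e f := by
  rintro c ⟨⟨-, hc, -⟩, -⟩
  refine h ((Ideal.jacobson (⊥ : Ideal A)).restrictScalars F |>.comap (LinearMap.mulLeft F c))
    fun k hk a => ⟨?_, ?_⟩
  · have hk' : c * k ∈ Ideal.jacobson (⊥ : Ideal A) := hk
    have h : c * (a * k) = a * (c * k) + (c * a - a * c) * k := by noncomm_ring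
    change c * (a * k) ∈ Ideal.jacobson (⊥ : Ideal A)
    rw [h]
    exact add_mem (Ideal.mul_mem_left _ _ hk') (Ideal.mul_mem_right _ _ (hc a trivial))
  · have hk' : c * k ∈ Ideal.jacobson (⊥ : Ideal A) := hk
    change c * (k * a) ∈ Ideal.jacobson (⊥ : Ideal A)
    rw [← mul_assoc]
    exact Ideal.mul_mem_right _ _ hk'

theorem lie_lie_eq_of_mul_eq_zero {b b' : A} (h : b * b' = 0) (h' : b' * b = 0) (x : A) :
    ⁅b, ⁅b', x⁆⁆ = -(b * x * b' + b' * x * b) := by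
  simp only [Ring.lie_def, mul_sub, sub_mul, ← mul_assoc, h, zero_mul]
  simp only [mul_assoc, h', mul_zero]
  abel

/-- **Theorem (main).** Let `A` be a 1-perfect finite-dimensional unital associative
algebra over an algebraically closed field `F` of characteristic `p ≠ 2, 3`, let `A'`
be a subalgebra of `A`, and let `B'` be a bar-minimal Jordan-Lie inner ideal of the
Lie algebra `A'⁽⁻⁾` (bar-minimality w.r.t. the image in `A'/rad A'`).  Then there is a
strict orthogonal idempotent pair `(e, f)` in `A` such that `B' ⊆ eAf`. -/
theorem main_theorem (F A : Type*) [Field F] [IsAlgClosed F] (p : ℕ) [CharP F p]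
    (hp2 : p ≠ 2) (hp3 : p ≠ 3) [Ring A] [Algebra F A] [FiniteDimensional F A]
    (h1perf : IsOnePerfect (⊤ : Submodule F A))
    (A' : Subalgebra F A) (B' : Submodule F A)
    (hJLie : IsJordanLie (Subalgebra.toSubmodule A') B')
    (hmin : ∀ B₀ : Submodule F A, IsInnerIdeal (Subalgebra.toSubmodule A') B₀ →
      B₀ ≤ B' →
      (∀ x ∈ B', ∃ y ∈ B₀, x - y ∈ subalgRad A') → B₀ = B') :
    ∃ e f : A, IsStrictPair e f ∧ e * f = 0 ∧ f * e = 0 ∧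
      ∀ b ∈ B', ∃ x : A, b = e * x * f := by
  obtain ⟨⟨hle, hinner⟩, hsq⟩ := hJLie
  have h2 : (2 : F) ≠ 0 := by
    intro h
    have hdvd : p ∣ 2 := (CharP.cast_eq_zero_iff F p 2).1 (by exact_mod_cast h)
    rcases (Nat.dvd_prime Nat.prime_two).1 hdvd with h1 | h1
    · exact CharP.char_ne_one F p h1
    · exact hp2 h1
  have hJ : ∀ b ∈ B', ∀ b' ∈ B', ∀ x ∈ A', b * x * b' + b' * x * b ∈ B' := by
    intro b hb b' hb' x hx
    have h := hinner b hb b' hb' x hx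
    rwa [lie_lie_eq_of_mul_eq_zero (hsq _ hb _ hb') (hsq _ hb' _ hb), B'.neg_mem_iff] at h
  have hU : ∀ b ∈ B', ∀ x ∈ A', b * x * b ∈ B' := by
    intro b hb x hx
    have h := hJ b hb b hb x hx
    rwa [← two_smul F, B'.smul_mem_iff h2] at h
  let ι : A' →ₗ[F] A := A'.val.toLinearMap
  obtain ⟨e, f, he, hf, hef, hfe, hB, hK⟩ := exists_idempotent_pair (B := B'.comap ι)
    (isNilWithRegularQuotient_jacobson (F := F) (A := A'))
    (fun b hb b' hb' => Subtype.ext (hsq _ hb _ hb'))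
    (fun b hb b' hb' x => hJ _ hb _ hb' _ x.2) (fun b hb x => hU _ hb _ x.2) (by
      intro C hCB hC hCN
      have h := hmin (C.map ι) ⟨?_, ?_⟩ ?_ ?_
      · rw [← h, Submodule.comap_map_eq_of_injective Subtype.val_injective]
      · rintro _ ⟨c, -, rfl⟩
        exact c.2
      · rintro _ ⟨b, hb, rfl⟩ _ ⟨b', hb', rfl⟩ x hx
        rw [lie_lie_eq_of_mul_eq_zero (hsq _ (hCB hb) _ (hCB hb')) (hsq _ (hCB hb') _ (hCB hb))]
        have hmem {c d : A'} (hc : c ∈ C) (hd : d ∈ C) : c * ⟨x, hx⟩ * d ∈ C :=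
          hC (Submodule.mul_mem_mul (Submodule.mul_mem_mul hc trivial) hd)
        exact neg_mem ⟨_, add_mem (hmem hb hb') (hmem hb' hb), rfl⟩
      · rintro _ ⟨c, hc, rfl⟩
        exact hCB hc
      · intro x hx
        obtain ⟨c, hc, hxc⟩ := hCN ⟨x, hle hx⟩ hx
        exact ⟨c, ⟨c, hc, rfl⟩, _, hxc, rfl⟩)
  refine ⟨e, f, ⟨congrArg Subtype.val he, congrArg Subtype.val hf, ?_⟩,
    congrArg Subtype.val hef, congrArg Subtype.val hfe, fun b hb =>
      ⟨b, congrArg Subtype.val (hB ⟨b, hle hb⟩ hb)⟩⟩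
  exact isStrictPairMod_jacobson (F := F) fun K hK' =>
    hK (K.comap ι) fun k hk a => hK' _ hk _

end Paper
end

section
/- Let A be a 1-perfect finite-dimensional unital associative algebra over an algebraically closed field F of characteristic p with p ≠ 2 and p ≠ 3, let A' be a subalgebra of A that is perfect as an associative algebra, and let (e',f') be a strict orthogonal idempotent pair in A' (strictness taken with respect to A'/rad A'). Then there exists a strict orthogonal idempotent pair (e,f) in A such that e'A'f' ⊆ eAf. -/
namespace Paper

variable (F A : Type*) [Field F] [Ring A] [Algebra F A]

variable {F A}

/-- A central idempotent of a simple ring is trivial. -/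
theorem eq_zero_or_one_of_central_idempotent {S : Type*} [Ring S] [IsSimpleRing S] {c : S}
    (hcent : ∀ s, c * s = s * c) (hc : c * c = c) : c = 0 ∨ c = 1 := by
  by_cases h0 : c = 0
  · exact Or.inl h0
  right
  have hmem : c ∈ Subring.center S := Subring.mem_center_iff.2 fun s => (hcent s).symm
  obtain ⟨d, hd⟩ := (IsSimpleRing.isField_center S).mul_inv_cancel
    (a := ⟨c, hmem⟩) fun h => h0 (congrArg Subtype.val h)
  have hd' : c * (d : S) = 1 := congrArg Subtype.val hd
  calc c = c * (c * d) := by rw [hd', mul_one]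
    _ = 1 := by rw [← mul_assoc, hc, hd']

/-- The quotient of an Artinian ring by its radical, as a surjection onto a finite product of
simple rings. -/
theorem exists_surjective_pi_simple.{u} (B : Type u) [Ring B] [IsArtinianRing B] :
    ∃ (n : ℕ) (S : Fin n → Type u) (_ : ∀ i, Ring (S i)) (_ : ∀ i, IsSimpleRing (S i))
      (φ : B →+* ∀ i, S i), Function.Surjective φ ∧
        ∀ x, x ∈ Ideal.jacobson (⊥ : Ideal B) ↔ φ x = 0 := by
  obtain ⟨n, D, d, _, _, ⟨ψ⟩⟩ :=
    IsSemisimpleRing.exists_ringEquiv_pi_matrix_divisionRing (B ⧸ Ring.jacobson B)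
  refine ⟨n, fun i => Matrix (Fin (d i)) (Fin (d i)) (D i), fun _ => inferInstance,
    fun i => inferInstance, (ψ : _ →+* _).comp (Ideal.Quotient.mk (Ring.jacobson B)),
    ψ.surjective.comp Ideal.Quotient.mk_surjective, fun x => ?_⟩
  rw [Ideal.jacobson_bot, ← Ideal.Quotient.eq_zero_iff_mem]
  simp

section Pi

variable {F A : Type*} [Field F] [Ring A] [Algebra F A] {A' : Subalgebra F A} {ρ : Set A}
  {n : ℕ} {S : Fin n → Type*} [∀ i, Ring (S i)] [∀ i, IsSimpleRing (S i)]
  {φ : A' →+* ∀ i, S i}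

/-- The identity of a simple factor lifts to a primitive central idempotent. -/
theorem isPrimitiveCentralIdempotentMod_of_single (hφ : Function.Surjective φ)
    (hρ : ∀ x : A', (x : A) ∈ ρ ↔ φ x = 0) {i : Fin n} {u : A'} (hu : φ u = Pi.single i 1) :
    IsPrimitiveCentralIdempotentMod (A' : Set A) ρ (u : A) := by
  have central (c : A') (hc : IsCentralIdempotentMod (A' : Set A) ρ (c : A)) :
      φ c i = 0 ∨ φ c i = 1 := by
    apply eq_zero_or_one_of_central_idempotent
    · intro s
      obtain ⟨x, hx⟩ := hφ (Pi.single i s)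
      have h := (hρ (c * x - x * c)).1 (hc.2.1 x x.2)
      have h' := congrFun h i
      simpa [hx, sub_eq_zero] using h'
    · have h := congrFun ((hρ (c * c - c)).1 hc.2.2) i
      simpa [sub_eq_zero] using h
  refine ⟨⟨u.2, fun a ha => (hρ (u * ⟨a, ha⟩ - ⟨a, ha⟩ * u)).2 ?_,
    (hρ (u * u - u)).2 ?_⟩, fun h => ?_, ?_⟩
  · rw [map_sub, map_mul, map_mul, hu]
    ext j
    rcases eq_or_ne j i with rfl | hj
    · simp
    · simp [hj]
  · rw [map_sub, map_mul, hu]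
    ext j
    rcases eq_or_ne j i with rfl | hj
    · simp
    · simp [hj]
  · have h' := congrFun ((hρ u).1 h) i
    simp [hu] at h'
  · rintro ⟨c₁, c₂, h₁, h₂, hn₁, hn₂, h₁₂, h₂₁, hsum⟩
    lift c₁ to A' using h₁.1
    lift c₂ to A' using h₂.1
    have h12 : φ c₁ * φ c₂ = 0 := by rw [← map_mul]; exact (hρ (c₁ * c₂)).1 h₁₂
    have h21 : φ c₂ * φ c₁ = 0 := by rw [← map_mul]; exact (hρ (c₂ * c₁)).1 h₂₁
    have hs : φ u = φ c₁ + φ c₂ := by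
      have := (hρ (u - (c₁ + c₂))).1 hsum
      rwa [map_sub, map_add, sub_eq_zero] at this
    have idem₁ : φ c₁ * φ c₁ = φ c₁ := by
      have := (hρ (c₁ * c₁ - c₁)).1 h₁.2.2
      rwa [map_sub, map_mul, sub_eq_zero] at this
    have idem₂ : φ c₂ * φ c₂ = φ c₂ := by
      have := (hρ (c₂ * c₂ - c₂)).1 h₂.2.2
      rwa [map_sub, map_mul, sub_eq_zero] at this
    have abs₁ : φ c₁ * φ u = φ c₁ := by rw [hs, mul_add, idem₁, h12, add_zero]
    have abs₂ : φ c₂ * φ u = φ c₂ := by rw [hs, mul_add, idem₂, h21, zero_add]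
    have one_of_abs (c : A') (hc : IsCentralIdempotentMod (A' : Set A) ρ (c : A))
        (hn : (c : A) ∉ ρ) (habs : φ c * φ u = φ c) : φ c i = 1 := by
      refine (central c hc).resolve_left fun h0 => hn ((hρ c).2 ?_)
      rw [← habs, hu]
      ext j
      rcases eq_or_ne j i with rfl | hj
      · simp [h0]
      · simp [hj]
    have h := congrFun h12 i
    simp [one_of_abs c₁ h₁ hn₁ abs₁, one_of_abs c₂ h₂ hn₂ abs₂] at h

/-- A two-sided ideal `J` containing `e` contains `f` modulo the radical as soon as `f` vanishes
in every simple factor where `e` vanishes. -/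
theorem exists_mem_map_eq (hφ : Function.Surjective φ)
    (hρ : ∀ x : A', (x : A) ∈ ρ ↔ φ x = 0) {e f : A'}
    (h : ∀ c : A, IsPrimitiveCentralIdempotentMod (A' : Set A) ρ c → c * e ∈ ρ → c * f ∈ ρ)
    (J : TwoSidedIdeal A') (he : e ∈ J) : ∃ j ∈ J, φ j = φ f := by
  choose u hu using fun i => hφ (Pi.single i 1)
  have local_lift (i : Fin n) : ∃ x ∈ J, φ x i = φ f i := by
    by_cases h0 : φ e i = 0
    · refine ⟨0, J.zero_mem, ?_⟩
      have hz : φ (u i * e) = 0 := by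
        rw [map_mul, hu]
        ext j
        rcases eq_or_ne j i with rfl | hj
        · simp [h0]
        · simp [hj]
      have hf := (hρ (u i * f)).1 (h _ (isPrimitiveCentralIdempotentMod_of_single hφ hρ (hu i))
        ((hρ (u i * e)).2 hz))
      have := congrFun hf i
      simpa [hu, eq_comm] using this
    · have hsurj (s : S i) : ∃ a : A', φ a i = s := by
        obtain ⟨a, ha⟩ := hφ (Pi.single i s)
        exact ⟨a, by simp [ha]⟩
      let K : TwoSidedIdeal (S i) := TwoSidedIdeal.mk' {s | ∃ x ∈ J, φ x i = s}
        ⟨0, J.zero_mem, by simp⟩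
        (by
          rintro _ _ ⟨x, hx, rfl⟩ ⟨y, hy, rfl⟩
          exact ⟨x + y, J.add_mem hx hy, by simp⟩)
        (by
          rintro _ ⟨x, hx, rfl⟩
          exact ⟨-x, J.neg_mem hx, by simp⟩)
        (by
          rintro s _ ⟨x, hx, rfl⟩
          obtain ⟨a, rfl⟩ := hsurj s
          exact ⟨a * x, J.mul_mem_left _ _ hx, by simp⟩)
        (by
          rintro _ s ⟨x, hx, rfl⟩
          obtain ⟨a, rfl⟩ := hsurj s
          exact ⟨x * a, J.mul_mem_right _ _ hx, by simp⟩)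
      have hK : φ e i ∈ K := (TwoSidedIdeal.mem_mk' ..).2 ⟨e, he, rfl⟩
      have h1 : (1 : S i) ∈ K := IsSimpleRing.one_mem_of_ne_zero_mem K h0 hK
      obtain ⟨x, hx, hx1⟩ := (TwoSidedIdeal.mem_mk' ..).1 h1
      exact ⟨x * f, J.mul_mem_right _ _ hx, by simp [hx1]⟩
  choose x hxJ hx using local_lift
  refine ⟨∑ i, u i * x i, sum_mem fun i _ => J.mul_mem_left _ _ (hxJ i), ?_⟩
  ext k
  rw [map_sum, Finset.sum_apply, Finset.sum_eq_single k]
  · simp [hu, hx]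
  · intro b _ hb
    simp [hu, hb.symm]
  · simp

end Pi

/-- One half of the transfer of strictness from a subalgebra to the whole algebra. -/
theorem mul_mem_jacobson_of_subalgebra {F A : Type*} [Field F] [Ring A] [Algebra F A]
    [FiniteDimensional F A] (A' : Subalgebra F A) {e f : A} (he : e ∈ A') (hf : f ∈ A')
    (hff : f * f = f)
    (h : ∀ c : A, IsPrimitiveCentralIdempotentMod (A' : Set A) (subalgRad A') c →
      c * e ∈ subalgRad A' → c * f ∈ subalgRad A')
    {c : A} (hc : IsCentralIdempotentMod Set.univ
      ((Ideal.jacobson (⊥ : Ideal A)) : Set A) c)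
    (hce : c * e ∈ Ideal.jacobson (⊥ : Ideal A)) :
    c * f ∈ Ideal.jacobson (⊥ : Ideal A) := by
  lift e to A' using he
  lift f to A' using hf
  have : IsArtinianRing A' := IsArtinianRing.of_finite F A'
  obtain ⟨n, S, _, _, φ, hφ, hker⟩ := exists_surjective_pi_simple A'
  have hρ (x : A') : (x : A) ∈ subalgRad A' ↔ φ x = 0 := by
    rw [← hker]
    exact Subtype.val_injective.mem_set_image
  let π := Ideal.Quotient.mk (Ideal.jacobson (⊥ : Ideal A))
  have hπ {x : A} : π x = 0 ↔ x ∈ Ideal.jacobson (⊥ : Ideal A) := Ideal.Quotient.eq_zero_iff_mem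
  have hcomm (a : A) : π c * π a = π a * π c := by
    rw [← sub_eq_zero, ← map_mul, ← map_mul, ← map_sub]
    exact hπ.2 (hc.2.1 a trivial)
  have hcc : π c * π c = π c := by
    rw [← sub_eq_zero, ← map_mul, ← map_sub]
    exact hπ.2 hc.2.2
  let J : TwoSidedIdeal A' := TwoSidedIdeal.mk' {x | π c * π x = 0} (by simp)
    (by
      intro x y hx hy
      simp only [Set.mem_ofPred_eq] at hx hy ⊢
      simp [mul_add, hx, hy])
    (by
      intro x hx
      simp only [Set.mem_ofPred_eq] at hx ⊢
      simp [hx])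
    (by
      intro x y hy
      simp only [Set.mem_ofPred_eq] at hy ⊢
      rw [MulMemClass.coe_mul, map_mul, ← mul_assoc, hcomm, mul_assoc, hy, mul_zero])
    (by
      intro x y hx
      simp only [Set.mem_ofPred_eq] at hx ⊢
      rw [MulMemClass.coe_mul, map_mul, ← mul_assoc, hx, zero_mul])
  have hJ (x : A') : x ∈ J ↔ π c * π x = 0 := TwoSidedIdeal.mem_mk' ..
  have heJ : e ∈ J := (hJ e).2 <| by simpa only [map_mul] using hπ.2 hce
  obtain ⟨j, hjJ, hj⟩ := exists_mem_map_eq hφ hρ h J heJ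
  have hcj : π c * π j = 0 := (hJ j).1 hjJ
  have hr : f - j ∈ Ideal.jacobson (⊥ : Ideal A') := by
    rw [hker, map_sub, hj, sub_self]
  have hnil : IsNilpotent (f - j) := by
    obtain ⟨m, hm⟩ := IsArtinianRing.isNilpotent_jacobson_bot (R := A')
    refine ⟨m, ?_⟩
    have := Ideal.pow_mem_pow hr m
    rwa [hm] at this
  have hnil' : IsNilpotent (π (f - j : A')) := hnil.map (π.comp A'.val.toRingHom)
  have hcf : π c * π f = π c * π (f - j : A') := by
    simp [mul_sub, hcj]
  have hidem : IsIdempotentElem (π c * π f) := by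
    change π c * π f * (π c * π f) = π c * π f
    rw [mul_assoc, ← mul_assoc (π f), ← hcomm, mul_assoc (π c) (π f), ← map_mul π (f : A) f, hff,
      ← mul_assoc, hcc]
  rw [← hπ, map_mul]
  refine hidem.eq_zero_of_isNilpotent ?_
  rw [hcf]
  exact Commute.isNilpotent_mul_left (hcomm _) hnil'

/-- **Corollary (3).** Let `A` be 1-perfect finite-dimensional over an algebraically
closed field of characteristic `p ≠ 2,3`, let `A'` be a subalgebra of `A` which is
perfect as an associative algebra, and let `(e', f')` be a strict orthogonal
idempotent pair in `A'`.  Then there is a strict orthogonal idempotent pair `(e, f)`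
in `A` with `e'A'f' ⊆ eAf`. -/
theorem corollary_three (F A : Type*) [Field F] [IsAlgClosed F] (p : ℕ) [CharP F p]
    (hp2 : p ≠ 2) (hp3 : p ≠ 3) [Ring A] [Algebra F A] [FiniteDimensional F A]
    (h1perf : IsOnePerfect (⊤ : Submodule F A))
    (A' : Subalgebra F A)
    (hperf : Submodule.span F {z : A | ∃ x ∈ A', ∃ y ∈ A', z = x * y} =
      Subalgebra.toSubmodule A')
    (e' f' : A) (he'A : e' ∈ A') (hf'A : f' ∈ A')
    (he' : e' * e' = e') (hf' : f' * f' = f')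
    (horth' : e' * f' = 0 ∧ f' * e' = 0)
    (hstrict' : IsStrictPairMod (A' : Set A) (subalgRad A') e' f') :
    ∃ e f : A, IsStrictPair e f ∧ e * f = 0 ∧ f * e = 0 ∧
      ∀ x ∈ A', ∃ y : A, e' * x * f' = e * y * f := by
  refine ⟨e', f', ⟨he', hf', fun c hc => ⟨?_, ?_⟩⟩, horth'.1, horth'.2, fun x _ => ⟨x, rfl⟩⟩
  · exact mul_mem_jacobson_of_subalgebra A' he'A hf'A hf' (fun d hd => (hstrict' d hd).1) hc.1
  · exact mul_mem_jacobson_of_subalgebra A' hf'A he'A he' (fun d hd => (hstrict' d hd).2) hc.1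

end Paper
end

section
/- Let A be a finite-dimensional unital associative algebra over an algebraically closed field F of characteristic p with p ≠ 2 and p ≠ 3, let I be a two-sided ideal of A, and let B be a bar-minimal Jordan-Lie inner ideal of the Lie algebra [I,I] = I^(1) (bar-minimality with respect to the image modulo rad A ∩ I). Then there exists a strict orthogonal idempotent pair (e,f) in A such that B = eAf. -/
namespace Paper

variable (F A : Type*) [Field F] [Ring A] [Algebra F A]

variable {F A}

section PeirceCorners

theorem mul_mul_of_mul_eq {A : Type*} [Semigroup A] {a b c : A} (h : a * b = c) (t : A) :
    a * (b * t) = c * t := by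
  rw [← mul_assoc, h]

/-- An element outside the Jacobson radical of a finite-dimensional algebra has a right multiple
which is a nonzero idempotent. -/
theorem exists_mul_idempotent_of_notMem_jacobson {F A : Type*} [Field F] [Ring A] [Algebra F A]
    [FiniteDimensional F A] {c : A} (hc : c ∉ Ideal.jacobson (⊥ : Ideal A)) :
    ∃ d : A, c * d * (c * d) = c * d ∧ c * d ≠ 0 := by
  rw [Ideal.mem_jacobson_iff] at hc
  push Not at hc
  obtain ⟨y, hy⟩ := hc
  have hyc : ¬ IsNilpotent (y * c) := by
    intro hn
    obtain ⟨u, hu⟩ := hn.isUnit_add_one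
    refine hy (↑u⁻¹) ?_
    have h : (↑u⁻¹ : A) * (y * c + 1) = 1 := by rw [← hu]; simp
    rw [Ideal.mem_bot, mul_assoc, ← h]
    noncomm_ring
  have hcy : ∀ n : ℕ, (c * y) ^ n ≠ 0 := by
    intro n hn
    refine hyc ⟨n + 1, ?_⟩
    have h : ∀ m : ℕ, (y * c) ^ (m + 1) = y * (c * y) ^ m * c := by
      intro m
      induction m with
      | zero => simp
      | succ m ih => rw [pow_succ, ih, pow_succ (c * y)]; simp only [mul_assoc]
    rw [h, hn, mul_zero, zero_mul]
  set t := c * y with ht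
  let T := Algebra.adjoin F ({t} : Set A)
  have : IsMulCommutative T := Algebra.isMulCommutative_adjoin_singleton F t
  have : IsArtinianRing T := IsArtinianRing.of_finite F T
  let τ : T := ⟨t, Algebra.self_mem_adjoin_singleton F t⟩
  obtain ⟨n, s, hs⟩ := IsArtinian.exists_pow_succ_smul_dvd τ (1 : T)
  simp only [smul_eq_mul, mul_one, Nat.succ_eq_add_one] at hs
  have hk : ∀ k : ℕ, τ ^ (n + k) * s ^ k = τ ^ n := by
    intro k
    induction k with
    | zero => simp
    | succ k ih =>
      calc τ ^ (n + (k + 1)) * s ^ (k + 1) = (τ ^ (n + 1) * s) * τ ^ k * s ^ k := by ring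
        _ = τ ^ (n + k) * s ^ k := by rw [hs]; ring
        _ = τ ^ n := ih
  have hE : τ ^ (n + 1) * (τ ^ (n + 1) * s ^ (n + 1)) = τ ^ (n + 1) := by
    calc _ = τ * (τ ^ (n + (n + 1)) * s ^ (n + 1)) := by ring
      _ = τ ^ (n + 1) := by rw [hk]; ring
  have hval : ((τ ^ (n + 1) * s ^ (n + 1) : T) : A) = c * (y * t ^ n * (s : A) ^ (n + 1)) := by
    have hτ : ((τ : T) : A) = t := rfl
    rw [MulMemClass.coe_mul, SubmonoidClass.coe_pow, SubmonoidClass.coe_pow, hτ, pow_succ' t]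
    nth_rw 1 [ht]
    simp only [mul_assoc]
  refine ⟨y * t ^ n * (s : A) ^ (n + 1), ?_, ?_⟩
  · rw [← hval, ← MulMemClass.coe_mul]
    congr 1
    calc _ = (τ ^ (n + 1) * (τ ^ (n + 1) * s ^ (n + 1))) * s ^ (n + 1) := by ring
      _ = _ := by rw [hE]
  · rw [← hval]
    intro h0
    have h0' : τ ^ (n + 1) * s ^ (n + 1) = 0 := Subtype.ext h0
    rw [h0', mul_zero] at hE
    exact hcy (n + 1) (congrArg Subtype.val hE.symm)

variable {F A : Type*} [Field F] [Ring A] [Algebra F A]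

/-- The subspace `AfA` spanned by all products `a * f * b`. -/
def sandwich (F : Type*) {A : Type*} [Field F] [Ring A] [Algebra F A] (f : A) : Submodule F A :=
  Submodule.span F {z : A | ∃ a b : A, z = a * f * b}

theorem mul_mul_mem_sandwich (a f b : A) : a * f * b ∈ sandwich F f :=
  Submodule.subset_span ⟨a, b, rfl⟩

theorem mem_sandwich_of_eq {a f b v : A} (h : a * f * b = v) : v ∈ sandwich F f :=
  h ▸ mul_mul_mem_sandwich a f b

theorem mul_mul_mem_of_mem_sandwich {e f : A} (he : e ∈ sandwich F f) (W : Submodule F A)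
    (u v : A) (h : ∀ a b : A, u * (a * f * b) * v ∈ W) : u * e * v ∈ W := by
  have hle : sandwich F f ≤
      W.comap ((LinearMap.mulRight F v).comp (LinearMap.mulLeft F u)) := by
    refine Submodule.span_le.2 ?_
    rintro _ ⟨a, b, rfl⟩
    exact h a b
  exact hle he

theorem sandwich_le {f f' : A} (h : f ∈ sandwich F f') : sandwich F f ≤ sandwich F f' := by
  refine Submodule.span_le.2 ?_
  rintro _ ⟨a, b, rfl⟩
  refine mul_mul_mem_of_mem_sandwich h _ a b fun x y => ?_
  have : a * (x * f' * y) * b = (a * x) * f' * (y * b) := by simp only [mul_assoc]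
  exact this ▸ mul_mul_mem_sandwich _ _ _

/-- The Peirce corner `eAf` for idempotents `e` and `f`. -/
def corner (F : Type*) {A : Type*} [Field F] [Ring A] [Algebra F A] (e f : A) : Submodule F A where
  carrier := {z | e * z * f = z}
  add_mem' {x y} hx hy := by
    simp only [Set.mem_ofPred_eq] at *
    rw [mul_add, add_mul, hx, hy]
  zero_mem' := by simp
  smul_mem' r x hx := by
    simp only [Set.mem_ofPred_eq] at *
    rw [mul_smul_comm, smul_mul_assoc, hx]

theorem mem_corner {e f z : A} : z ∈ corner F e f ↔ e * z * f = z := Iff.rfl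

/-- Jordan closure properties of a Jordan-Lie inner ideal `B` of `[I, I]`. -/
structure IsJordanClosed (I B : Submodule F A) : Prop where
  ideal : ∀ a : A, ∀ x ∈ I, a * x ∈ I ∧ x * a ∈ I
  le : B ≤ I
  mul_eq_zero : ∀ b ∈ B, ∀ b' ∈ B, b * b' = 0
  triple : ∀ b ∈ B, ∀ b' ∈ B, ∀ x ∈ I, ∀ y ∈ I,
    b * (x * y - y * x) * b' + b' * (x * y - y * x) * b ∈ B
  quadratic : ∀ b ∈ B, ∀ x ∈ I, ∀ y ∈ I, b * (x * y - y * x) * b ∈ B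

/-- Orthogonal idempotents of `I` generating the same two-sided ideal, with `eAf ⊆ B`. -/
structure IsCornerPair (I B : Submodule F A) (e f : A) : Prop where
  left_mem : e ∈ I
  right_mem : f ∈ I
  left_idem : e * e = e
  right_idem : f * f = f
  left_right : e * f = 0
  right_left : f * e = 0
  left_sandwich : e ∈ sandwich F f
  right_sandwich : f ∈ sandwich F e
  corner_mem : ∀ a : A, e * a * f ∈ B

variable {I B : Submodule F A} {e f b : A}

namespace IsCornerPair

theorem mul_left_eq_zero (hB : IsJordanClosed I B) (h : IsCornerPair I B e f) (hb : b ∈ B) :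
    b * e = 0 := by
  have := mul_mul_mem_of_mem_sandwich h.left_sandwich ⊥ (b * e) 1 fun x y => by
    have h1 : b * e * (x * f * y) * 1 = b * (e * x * f) * y := by simp only [mul_assoc, mul_one]
    rw [h1, hB.mul_eq_zero b hb _ (h.corner_mem x), zero_mul]
    exact Submodule.zero_mem _
  rwa [mul_one, Submodule.mem_bot, mul_assoc, h.left_idem] at this

theorem right_mul_eq_zero (hB : IsJordanClosed I B) (h : IsCornerPair I B e f) (hb : b ∈ B) :
    f * b = 0 := by
  have := mul_mul_mem_of_mem_sandwich h.right_sandwich ⊥ 1 (f * b) fun x y => by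
    have h1 : 1 * (x * e * y) * (f * b) = x * ((e * y * f) * b) := by
      simp only [mul_assoc, one_mul]
    rw [h1, hB.mul_eq_zero _ (h.corner_mem y) b hb, mul_zero]
    exact Submodule.zero_mem _
  rwa [one_mul, Submodule.mem_bot, ← mul_assoc, h.right_idem] at this

theorem left_mul_mem (hB : IsJordanClosed I B) (h : IsCornerPair I B e f) (hb : b ∈ B)
    {x : A} (hxe : x * e = 0) (hxf : x * f = 0) : e * x * b ∈ B := by
  have key := mul_mul_mem_of_mem_sandwich h.left_sandwich B e (x * b) fun u v => by
    have hy : f * (f * (v * x)) - f * (v * x) * f = f * (v * x) := by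
      rw [← mul_assoc f f, h.right_idem, mul_assoc f (v * x), mul_assoc v, hxf, mul_zero, mul_zero,
        sub_zero]
    have := hB.triple _ (h.corner_mem u) b hb f h.right_mem (f * (v * x))
      (hB.ideal _ _ h.right_mem).2
    rw [hy] at this
    have h1 : b * (f * (v * x)) * (e * u * f) = 0 := by
      simp only [mul_assoc, mul_mul_of_mul_eq hxe, zero_mul, mul_zero]
    rw [h1, add_zero] at this
    convert this using 1
    simp only [mul_assoc, mul_mul_of_mul_eq h.right_idem]
  rwa [h.left_idem, ← mul_assoc] at key

theorem mul_right_mem (hB : IsJordanClosed I B) (h : IsCornerPair I B e f) (hb : b ∈ B)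
    {x : A} (hex : e * x = 0) (hfx : f * x = 0) : b * x * f ∈ B := by
  have key := mul_mul_mem_of_mem_sandwich h.right_sandwich B (b * x) f fun u v => by
    have hy : (x * u) * e * e - e * ((x * u) * e) = (x * u) * e := by
      simp only [mul_assoc, h.left_idem, mul_mul_of_mul_eq hex, zero_mul, sub_zero]
    have := hB.triple b hb _ (h.corner_mem v) (x * u * e)
      (hB.ideal _ _ h.left_mem).1 e h.left_mem
    rw [hy] at this
    have h1 : e * v * f * (x * u * e) * b = 0 := by
      simp only [mul_assoc, mul_mul_of_mul_eq hfx, zero_mul, mul_zero]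
    rw [h1, add_zero] at this
    convert this using 1
    simp only [mul_assoc, mul_mul_of_mul_eq h.left_idem]
  rwa [mul_assoc, h.right_idem] at key

/-- A left factor of `B` outside the radical enlarges the left idempotent. -/
theorem exists_larger_left [FiniteDimensional F A] (hB : IsJordanClosed I B)
    (h : IsCornerPair I B e f) (hb : b ∈ B) (hebf : e * b * f = 0)
    (hbf : b * f ∉ Ideal.jacobson (⊥ : Ideal A)) :
    ∃ e' f' : A, IsCornerPair I B e' f' ∧ corner F e f < corner F e' f' := by
  obtain ⟨d, hd, hd0⟩ := exists_mul_idempotent_of_notMem_jacobson (F := F) hbf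
  have hfb := h.right_mul_eq_zero hB hb
  obtain ⟨e₁, he₁⟩ : ∃ e₁, e₁ = b * f * d := ⟨_, rfl⟩
  rw [← he₁] at hd hd0
  obtain ⟨g, hg⟩ : ∃ g, g = 1 - e - f := ⟨_, rfl⟩
  have hge : g * e = 0 := by rw [hg, sub_mul, sub_mul, h.left_idem, h.right_left]; simp
  have hgf : g * f = 0 := by rw [hg, sub_mul, sub_mul, h.right_idem, h.left_right]; simp
  have hee₁ : e * e₁ = 0 := by rw [he₁, ← mul_assoc, ← mul_assoc, hebf, zero_mul]
  have hfe₁ : f * e₁ = 0 := by rw [he₁, ← mul_assoc, ← mul_assoc, hfb, zero_mul, zero_mul]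
  have hge₁ : g * e₁ = e₁ := by rw [hg, sub_mul, sub_mul, hee₁, hfe₁]; simp
  obtain ⟨e₂, he₂⟩ : ∃ e₂, e₂ = e₁ * g := ⟨_, rfl⟩
  have he₂e₂ : e₂ * e₂ = e₂ := by
    rw [he₂, mul_assoc, mul_mul_of_mul_eq hge₁, mul_mul_of_mul_eq hd]
  have he₂0 : e₂ ≠ 0 := by
    intro h0
    apply hd0
    have : e₂ * e₁ = e₁ := by rw [he₂, mul_assoc, hge₁, hd]
    rw [← this, h0, zero_mul]
  have hee₂ : e * e₂ = 0 := by rw [he₂, mul_mul_of_mul_eq hee₁, zero_mul]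
  have hfe₂ : f * e₂ = 0 := by rw [he₂, mul_mul_of_mul_eq hfe₁, zero_mul]
  have he₂e : e₂ * e = 0 := by rw [he₂, mul_assoc, hge, mul_zero]
  have he₂f : e₂ * f = 0 := by rw [he₂, mul_assoc, hgf, mul_zero]
  obtain ⟨x, hx⟩ : ∃ x, x = f * d * e₂ := ⟨_, rfl⟩
  have hfx : f * x = x := by rw [hx, mul_assoc, mul_mul_of_mul_eq h.right_idem]
  have hxf : x * f = 0 := by rw [hx, mul_assoc, he₂f, mul_zero]
  have hxI : x ∈ I := by rw [hx, mul_assoc]; exact (hB.ideal _ _ h.right_mem).2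
  have hbx : b * x = e₂ := by
    rw [hx, mul_assoc, ← mul_assoc, ← mul_assoc, ← he₁, he₂, ← mul_assoc, hd]
  have hb' : e₂ * b ∈ B := by
    have := hB.quadratic b hb f h.right_mem x hxI
    rwa [hfx, hxf, sub_zero, hbx] at this
  have hmem : ∀ a : A, e₂ * a * f ∈ B := by
    intro a
    have key := mul_mul_mem_of_mem_sandwich h.right_sandwich B (e₂ * b * f) (x * a * f)
      fun u v => by
        have hy : f * u * e * e - e * (f * u * e) = f * u * e := by
          simp only [mul_assoc, h.left_idem, mul_mul_of_mul_eq h.left_right, zero_mul, sub_zero]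
        have := hB.triple _ hb' _ (h.corner_mem (v * (x * a))) (f * u * e)
          (hB.ideal _ _ h.left_mem).1 e h.left_mem
        rw [hy] at this
        have h1 : e * (v * (x * a)) * f * (f * u * e) * (e₂ * b) = 0 := by
          simp only [mul_assoc, mul_mul_of_mul_eq hee₂, zero_mul, mul_zero]
        rw [h1, add_zero] at this
        convert this using 1
        simp only [mul_assoc, mul_mul_of_mul_eq h.left_idem]
    convert key using 1
    simp only [mul_assoc, mul_mul_of_mul_eq hfx, mul_mul_of_mul_eq hbx,
      mul_mul_of_mul_eq he₂e₂]
  have he₂I : e₂ ∈ I := by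
    rw [← hbx]; exact (hB.ideal _ _ hxI).1
  refine ⟨e + e₂, f, ⟨I.add_mem h.left_mem he₂I, h.right_mem, ?_, h.right_idem, ?_, ?_, ?_, ?_,
    fun a => ?_⟩, ?_⟩
  · rw [add_mul, mul_add, mul_add, h.left_idem, hee₂, he₂e, he₂e₂]; simp
  · rw [add_mul, h.left_right, he₂f, add_zero]
  · rw [mul_add, h.right_left, hfe₂, add_zero]
  · refine Submodule.add_mem _ h.left_sandwich ?_
    rw [← hbx, ← hfx, ← mul_assoc]
    exact mul_mul_mem_sandwich _ _ _
  · refine sandwich_le ?_ h.right_sandwich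
    have : e * (e + e₂) * 1 = e := by rw [mul_one, mul_add, h.left_idem, hee₂, add_zero]
    exact mem_sandwich_of_eq this
  · rw [add_mul, add_mul]
    exact B.add_mem (h.corner_mem a) (hmem a)
  · refine lt_of_le_of_ne ?_ ?_
    · intro z hz
      rw [mem_corner] at hz ⊢
      have h2 : e₂ * z = 0 := by
        rw [← hz, ← mul_assoc, ← mul_assoc, he₂e, zero_mul, zero_mul]
      rw [add_mul, h2, add_zero, hz]
    · intro heq
      have hz : e₂ * b * f ∈ corner F (e + e₂) f := by
        rw [mem_corner]
        simp only [add_mul, mul_assoc, mul_mul_of_mul_eq hee₂, mul_mul_of_mul_eq he₂e₂,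
          h.right_idem, zero_mul, zero_add]
      rw [← heq, mem_corner] at hz
      simp only [mul_assoc, mul_mul_of_mul_eq hee₂, zero_mul] at hz
      apply he₂0
      calc e₂ = e₂ * (b * f) * x := by rw [mul_assoc, mul_assoc, hfx, hbx, he₂e₂]
        _ = 0 := by rw [← hz, zero_mul]

/-- A right factor of `B` outside the radical enlarges the right idempotent. -/
theorem exists_larger_right [FiniteDimensional F A] (hB : IsJordanClosed I B)
    (h : IsCornerPair I B e f) (hb : b ∈ B) (hebf : e * b * f = 0)
    (heb : e * b ∉ Ideal.jacobson (⊥ : Ideal A)) :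
    ∃ e' f' : A, IsCornerPair I B e' f' ∧ corner F e f < corner F e' f' := by
  obtain ⟨d, hd, hd0⟩ := exists_mul_idempotent_of_notMem_jacobson (F := F) heb
  have hbe := h.mul_left_eq_zero hB hb
  obtain ⟨g, hg⟩ : ∃ g, g = 1 - e - f := ⟨_, rfl⟩
  have hbg : e * b * g = e * b := by
    rw [hg, mul_sub, mul_sub, hebf, mul_assoc e b e, hbe]; simp
  have heg : e * g = 0 := by rw [hg, mul_sub, mul_sub, h.left_idem, h.left_right]; simp
  have hfg : f * g = 0 := by rw [hg, mul_sub, mul_sub, h.right_idem, h.right_left]; simp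
  obtain ⟨x, hx⟩ : ∃ x, x = g * d * (e * b * d) * e := ⟨_, rfl⟩
  have hxe : x * e = x := by rw [hx, mul_assoc, h.left_idem]
  have hex : e * x = 0 := by simp only [hx, mul_assoc, mul_mul_of_mul_eq heg, zero_mul]
  have hfx : f * x = 0 := by simp only [hx, mul_assoc, mul_mul_of_mul_eq hfg, zero_mul]
  have hxI : x ∈ I := by rw [hx]; exact (hB.ideal _ _ h.left_mem).1
  have hebx : e * b * x = e * b * d * e := by
    calc e * b * x = (e * b * g) * d * (e * b * d) * e := by rw [hx]; simp only [mul_assoc]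
      _ = (e * b * d) * (e * b * d) * e := by rw [hbg]
      _ = _ := by rw [hd]
  have hxbx : x * b * x = x := by
    calc x * b * x = x * (e * b * x) := by
          rw [← mul_assoc, ← mul_assoc, hxe]
      _ = g * d * (e * b * d) * (e * e * b * d) * e := by rw [hebx, hx]; simp only [mul_assoc]
      _ = g * d * ((e * b * d) * (e * b * d)) * e := by rw [h.left_idem]; simp only [mul_assoc]
      _ = x := by rw [hd, hx]
  have hx0 : x ≠ 0 := by
    intro h0
    apply hd0
    calc e * b * d = e * b * d * (e * b * d) := hd.symm
      _ = (e * b * d * e) * (b * d) := by simp only [mul_assoc]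
      _ = 0 := by rw [← hebx, h0, mul_zero, zero_mul]
  obtain ⟨f₂, hf₂⟩ : ∃ f₂, f₂ = x * b := ⟨_, rfl⟩
  have hf₂f₂ : f₂ * f₂ = f₂ := by rw [hf₂, ← mul_assoc, hxbx]
  have hf₂x : f₂ * x = x := by rw [hf₂, hxbx]
  have hf₂e : f₂ * e = 0 := by rw [hf₂, mul_assoc, hbe, mul_zero]
  have hef₂ : e * f₂ = 0 := by rw [hf₂, ← mul_assoc, hex, zero_mul]
  have hff₂ : f * f₂ = 0 := by rw [hf₂, ← mul_assoc, hfx, zero_mul]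
  have hf₂f : f₂ * f = 0 := by
    rw [hf₂, ← hxe, mul_assoc, mul_assoc, ← mul_assoc e, hebf, mul_zero]
  have hb' : b * f₂ ∈ B := by
    have := hB.quadratic b hb x hxI e h.left_mem
    rwa [hxe, hex, sub_zero, mul_assoc, ← hf₂] at this
  have hmem : ∀ a : A, e * a * f₂ ∈ B := by
    intro a
    have key := mul_mul_mem_of_mem_sandwich h.left_sandwich B (e * a * x) (e * b * f₂)
      fun u v => by
        have hy : f * (f * v * e) - f * v * e * f = f * v * e := by
          simp only [mul_assoc, h.left_right, mul_mul_of_mul_eq h.right_idem, mul_zero, sub_zero]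
        have := hB.triple _ (h.corner_mem (a * x * u)) _ hb' f h.right_mem (f * v * e)
          (hB.ideal _ _ h.left_mem).1
        rw [hy] at this
        have h1 : b * f₂ * (f * v * e) * (e * (a * x * u) * f) = 0 := by
          simp only [mul_assoc, mul_mul_of_mul_eq hf₂f, zero_mul, mul_zero]
        rw [h1, add_zero] at this
        convert this using 1
        simp only [mul_assoc, mul_mul_of_mul_eq h.right_idem]
    convert key using 1
    have h1 : x * (b * f₂) = f₂ := by rw [← mul_assoc, ← hf₂, hf₂f₂]
    simp only [mul_assoc, mul_mul_of_mul_eq h.left_idem, mul_mul_of_mul_eq hxe, h1]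
  have hf₂I : f₂ ∈ I := by rw [hf₂]; exact (hB.ideal _ _ hxI).2
  refine ⟨e, f + f₂, ⟨h.left_mem, I.add_mem h.right_mem hf₂I, h.left_idem, ?_, ?_, ?_, ?_, ?_,
    fun a => ?_⟩, ?_⟩
  · rw [add_mul, mul_add, mul_add, h.right_idem, hff₂, hf₂f, hf₂f₂]; simp
  · rw [mul_add, h.left_right, hef₂, add_zero]
  · rw [add_mul, h.right_left, hf₂e, add_zero]
  · refine sandwich_le ?_ h.left_sandwich
    have : f * (f + f₂) * 1 = f := by rw [mul_one, mul_add, h.right_idem, hff₂, add_zero]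
    exact mem_sandwich_of_eq this
  · refine Submodule.add_mem _ h.right_sandwich ?_
    rw [hf₂, ← hxe]
    exact mul_mul_mem_sandwich _ _ _
  · rw [mul_add]
    exact B.add_mem (h.corner_mem a) (hmem a)
  · refine lt_of_le_of_ne ?_ ?_
    · intro z hz
      rw [mem_corner] at hz ⊢
      have h2 : e * z * f₂ = 0 := by
        rw [← hz]
        simp only [mul_assoc, hff₂, mul_zero]
      rw [mul_add, h2, add_zero, hz]
    · intro heq
      have hz : e * b * f₂ ∈ corner F e (f + f₂) := by
        rw [mem_corner]
        simp only [mul_add, mul_assoc, mul_mul_of_mul_eq h.left_idem, hf₂f, hf₂f₂, mul_zero,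
          zero_add]
      rw [← heq, mem_corner] at hz
      simp only [mul_assoc, hf₂f, mul_zero] at hz
      apply hx0
      calc x = x * e * (b * (f₂ * x)) := by rw [hf₂x, hxe, ← mul_assoc, hxbx]
        _ = x * (e * (b * f₂)) * x := by simp only [mul_assoc]
        _ = 0 := by rw [← hz, mul_zero, zero_mul]

/-- A component of `B` outside the radical in the corner complementary to `e + f` enlarges both
idempotents. -/
theorem exists_larger_both [FiniteDimensional F A] (hB : IsJordanClosed I B)
    (h : IsCornerPair I B e f) (hb : b ∈ B)
    (hgbg : (1 - e - f) * b * (1 - e - f) ∉ Ideal.jacobson (⊥ : Ideal A)) :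
    ∃ e' f' : A, IsCornerPair I B e' f' ∧ corner F e f < corner F e' f' := by
  obtain ⟨d, hd, hd0⟩ := exists_mul_idempotent_of_notMem_jacobson (F := F) hgbg
  have hbe := h.mul_left_eq_zero hB hb
  have hfb := h.right_mul_eq_zero hB hb
  have hbb := hB.mul_eq_zero b hb b hb
  obtain ⟨g, hg⟩ : ∃ g, g = 1 - e - f := ⟨_, rfl⟩
  rw [← hg] at hd hd0
  have hge : g * e = 0 := by rw [hg, sub_mul, sub_mul, h.left_idem, h.right_left]; simp
  have hgf : g * f = 0 := by rw [hg, sub_mul, sub_mul, h.right_idem, h.left_right]; simp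
  have heg : e * g = 0 := by rw [hg, mul_sub, mul_sub, h.left_idem, h.left_right]; simp
  have hfg : f * g = 0 := by rw [hg, mul_sub, mul_sub, h.right_idem, h.right_left]; simp
  have hgg : g * g = g := by nth_rw 2 [hg]; rw [mul_sub, mul_sub, hge, hgf]; simp
  have hbgb : b * g * b = 0 := by
    rw [hg, mul_sub, mul_sub, sub_mul, sub_mul, hbe, mul_assoc b f b, hfb, mul_one, hbb]; simp
  obtain ⟨c, hc⟩ : ∃ c, c = g * b * g := ⟨_, rfl⟩
  rw [← hc] at hd hd0
  have hgc : g * c = c := by simp only [hc, mul_assoc, mul_mul_of_mul_eq hgg]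
  have hcg : c * g = c := by simp only [hc, mul_assoc, hgg]
  have hcc : c * c = 0 := by
    calc c * c = g * (b * (g * g) * b) * g := by simp only [hc, mul_assoc]
      _ = 0 := by rw [hgg, hbgb, mul_zero, zero_mul]
  obtain ⟨e₂, he₂⟩ : ∃ e₂, e₂ = c * d * g := ⟨_, rfl⟩
  have hge₂ : g * e₂ = e₂ := by rw [he₂, ← mul_assoc, ← mul_assoc, hgc]
  have he₂g : e₂ * g = e₂ := by rw [he₂, mul_assoc, hgg]
  have hce₂ : c * e₂ = 0 := by rw [he₂, ← mul_assoc, ← mul_assoc, hcc, zero_mul, zero_mul]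
  have he₂cd : e₂ * (c * d) = c * d := by
    calc e₂ * (c * d) = c * d * (g * c * d) := by rw [he₂]; simp only [mul_assoc]
      _ = c * d := by rw [hgc, hd]
  have he₂e₂ : e₂ * e₂ = e₂ := by
    nth_rw 2 [he₂]
    rw [← mul_assoc, he₂cd, ← he₂]
  have he₂0 : e₂ ≠ 0 := by
    intro h0
    apply hd0
    rw [← he₂cd, h0, zero_mul]
  obtain ⟨x, hx⟩ : ∃ x, x = (g - e₂) * d * e₂ := ⟨_, rfl⟩
  have hcx : c * x = e₂ := by
    calc c * x = (c * g - c * e₂) * d * e₂ := by rw [hx, ← mul_assoc, ← mul_assoc, mul_sub]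
      _ = c * d * e₂ := by rw [hcg, hce₂, sub_zero]
      _ = c * d * (c * d) * g := by rw [he₂]; simp only [mul_assoc]
      _ = e₂ := by rw [hd, he₂]
  have hxe₂ : x * e₂ = x := by rw [hx, mul_assoc, he₂e₂]
  have he₂x : e₂ * x = 0 := by
    rw [hx, ← mul_assoc, ← mul_assoc, mul_sub, he₂g, he₂e₂, sub_self, zero_mul, zero_mul]
  have hgx : g * x = x := by
    rw [hx, ← mul_assoc, ← mul_assoc, mul_sub, hgg, hge₂]
  have hxg : x * g = x := by rw [hx, mul_assoc, he₂g]
  have zero_of {s t u : A} (h1 : s * t = s) (h2 : t * u = 0) : s * u = 0 := by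
    rw [← h1, mul_assoc, h2, mul_zero]
  have zero_of' {s t u : A} (h1 : t * u = u) (h2 : s * t = 0) : s * u = 0 := by
    rw [← h1, ← mul_assoc, h2, zero_mul]
  have hcI : c ∈ I := by
    rw [hc]; exact (hB.ideal _ _ (hB.ideal _ _ (hB.le hb)).1).2
  have he₂I : e₂ ∈ I := by
    rw [he₂, mul_assoc]; exact (hB.ideal _ _ hcI).2
  have quad : ∀ b ∈ B, ∀ y : A, y * e₂ = y → e₂ * y = 0 → b * y * b ∈ B := by
    intro b hb y h1 h2
    have := hB.quadratic b hb y (h1 ▸ (hB.ideal _ _ he₂I).1) e₂ he₂I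
    rwa [h1, h2, sub_zero] at this
  have hbxb : b * x * b ∈ B := quad b hb x hxe₂ he₂x
  have hb₂ : e₂ * c ∈ B := by
    have h1 : e * (b * x) * b ∈ B :=
      h.left_mul_mem hB hb (by rw [mul_assoc, zero_of hxg hge, mul_zero])
        (by rw [mul_assoc, zero_of hxg hgf, mul_zero])
    have h2 : b * (x * b) * f ∈ B :=
      h.mul_right_mem hB hb (by rw [← mul_assoc, zero_of' hgx heg, zero_mul])
        (by rw [← mul_assoc, zero_of' hgx hfg, zero_mul])
    have h3 : e * (b * x * b) * f ∈ B := h.corner_mem _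
    have h4 : e₂ * c = b * x * b - e * (b * x) * b - b * (x * b) * f + e * (b * x * b) * f := by
      have h5 : g * b = b - e * b := by rw [hg, sub_mul, sub_mul, hfb, one_mul, sub_zero]
      have h6 : b * g = b - b * f := by rw [hg, mul_sub, mul_sub, hbe, mul_one, sub_zero]
      calc e₂ * c = g * b * (g * x * g) * (b * g) := by rw [← hcx, hc]; simp only [mul_assoc]
        _ = (b - e * b) * x * (b - b * f) := by rw [hgx, hxg, h5, h6]
        _ = _ := by noncomm_ring
    rw [h4]
    exact B.add_mem (B.sub_mem (B.sub_mem hbxb h1) h2) h3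
  obtain ⟨f₂, hf₂⟩ : ∃ f₂, f₂ = x * c := ⟨_, rfl⟩
  have hf₂f₂ : f₂ * f₂ = f₂ := by
    rw [hf₂, mul_assoc, mul_mul_of_mul_eq hcx, mul_mul_of_mul_eq hxe₂]
  have hgf₂ : g * f₂ = f₂ := by rw [hf₂, ← mul_assoc, hgx]
  have hf₂g : f₂ * g = f₂ := by rw [hf₂, mul_assoc, hcg]
  have he₂f₂ : e₂ * f₂ = 0 := by rw [hf₂, ← mul_assoc, he₂x, zero_mul]
  have hf₂e₂ : f₂ * e₂ = 0 := by rw [hf₂, mul_assoc, hce₂, mul_zero]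
  have hee₂ := zero_of' hge₂ heg
  have hfe₂ := zero_of' hge₂ hfg
  have he₂e := zero_of he₂g hge
  have he₂f := zero_of he₂g hgf
  have hef₂ := zero_of' hgf₂ heg
  have hff₂ := zero_of' hgf₂ hfg
  have hf₂e := zero_of hf₂g hge
  have hf₂f := zero_of hf₂g hgf
  have hf₂I : f₂ ∈ I := by rw [hf₂]; exact (hB.ideal _ _ hcI).1
  have hsum : e * (e + e₂) * 1 = e := by rw [mul_one, mul_add, h.left_idem, hee₂, add_zero]
  have hsum₂ : e₂ * (e + e₂) * 1 = e₂ := by rw [mul_one, mul_add, he₂e, he₂e₂, zero_add]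
  have hsumf : f * (f + f₂) * 1 = f := by rw [mul_one, mul_add, h.right_idem, hff₂, add_zero]
  have hsumf₂ : f₂ * (f + f₂) * 1 = f₂ := by rw [mul_one, mul_add, hf₂f, hf₂f₂, zero_add]
  have he₂S : e₂ ∈ sandwich F f₂ := mem_sandwich_of_eq (a := e₂ * c) (b := x) (by
    rw [hf₂]
    simp only [mul_assoc, hcx, mul_mul_of_mul_eq hcx, he₂e₂])
  have hf₂S : f₂ ∈ sandwich F e₂ := mem_sandwich_of_eq (a := x) (b := c) (by rw [hxe₂, hf₂])
  refine ⟨e + e₂, f + f₂, ⟨I.add_mem h.left_mem he₂I, I.add_mem h.right_mem hf₂I,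
    ?_, ?_, ?_, ?_, ?_, ?_, fun a => ?_⟩, ?_⟩
  · rw [add_mul, mul_add, mul_add, h.left_idem, hee₂, he₂e, he₂e₂]; simp
  · rw [add_mul, mul_add, mul_add, h.right_idem, hff₂, hf₂f, hf₂f₂]; simp
  · rw [add_mul, mul_add, mul_add, h.left_right, hef₂, he₂f, he₂f₂]; simp
  · rw [add_mul, mul_add, mul_add, h.right_left, hfe₂, hf₂e, hf₂e₂]; simp
  · exact Submodule.add_mem _ (sandwich_le (mem_sandwich_of_eq hsumf) h.left_sandwich)
      (sandwich_le (mem_sandwich_of_eq hsumf₂) he₂S)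
  · exact Submodule.add_mem _ (sandwich_le (mem_sandwich_of_eq hsum) h.right_sandwich)
      (sandwich_le (mem_sandwich_of_eq hsum₂) hf₂S)
  · have h1 : e * (a * x) * (e₂ * c) ∈ B :=
      h.left_mul_mem hB hb₂ (by rw [mul_assoc, zero_of hxg hge, mul_zero])
        (by rw [mul_assoc, zero_of hxg hgf, mul_zero])
    have h2 : e₂ * c * (x * a) * f ∈ B :=
      h.mul_right_mem hB hb₂ (by rw [← mul_assoc, zero_of' hgx heg, zero_mul])
        (by rw [← mul_assoc, zero_of' hgx hfg, zero_mul])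
    have h3 : e₂ * c * (x * a * x) * (e₂ * c) ∈ B :=
      quad _ hb₂ (x * a * x) (by rw [mul_assoc, hxe₂])
        (by rw [← mul_assoc, ← mul_assoc, he₂x, zero_mul, zero_mul])
    have h4 : (e + e₂) * a * (f + f₂) = e * a * f + e * (a * x) * (e₂ * c)
        + e₂ * c * (x * a) * f + e₂ * c * (x * a * x) * (e₂ * c) := by
      simp only [mul_assoc, mul_mul_of_mul_eq hcx, mul_mul_of_mul_eq he₂e₂,
        mul_mul_of_mul_eq hxe₂, hf₂, add_mul, mul_add]
      abel
    rw [h4]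
    exact B.add_mem (B.add_mem (B.add_mem (h.corner_mem a) h1) h2) h3
  · refine lt_of_le_of_ne ?_ ?_
    · intro z hz
      rw [mem_corner] at hz ⊢
      rw [← hz]
      simp only [add_mul, mul_add, mul_assoc, hff₂, h.right_idem, mul_mul_of_mul_eq he₂e,
        mul_mul_of_mul_eq h.left_idem, zero_mul, mul_zero, add_zero]
    · intro heq
      have hz : e₂ * c ∈ corner F (e + e₂) (f + f₂) := by
        rw [mem_corner]
        simp only [hf₂, add_mul, mul_add, mul_assoc, mul_mul_of_mul_eq hee₂,
          mul_mul_of_mul_eq he₂e₂, zero_of hcg hgf, mul_mul_of_mul_eq hcx, zero_mul, mul_zero,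
          zero_add]
      rw [← heq, mem_corner] at hz
      simp only [mul_mul_of_mul_eq hee₂, zero_mul] at hz
      apply he₂0
      rw [← he₂e₂]
      nth_rw 2 [← hcx]
      rw [← mul_assoc, ← hz, zero_mul]

end IsCornerPair

/-- A Jordan closed subspace contains a Peirce corner with the same image modulo the radical. -/
theorem IsJordanClosed.exists_cornerPair [FiniteDimensional F A] (hB : IsJordanClosed I B) :
    ∃ e f : A, IsCornerPair I B e f ∧
      ∀ b ∈ B, b - e * b * f ∈ Ideal.jacobson (⊥ : Ideal A) := by
  obtain ⟨S, ⟨e, f, h, rfl⟩, hmax⟩ := (wellFounded_gt (α := Submodule F A)).has_min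
    {S | ∃ e f : A, IsCornerPair I B e f ∧ S = corner F e f}
    ⟨_, 0, 0, ⟨I.zero_mem, I.zero_mem, by simp, by simp, by simp, by simp, Submodule.zero_mem _,
      Submodule.zero_mem _, by simp⟩, rfl⟩
  have hno : ¬ ∃ e' f' : A, IsCornerPair I B e' f' ∧ corner F e f < corner F e' f' := by
    rintro ⟨e', f', h', hlt⟩
    exact hmax _ ⟨e', f', h', rfl⟩ hlt
  refine ⟨e, f, h, fun b hb => ?_⟩
  obtain ⟨c, hc⟩ : ∃ c, c = b - e * b * f := ⟨_, rfl⟩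
  rw [← hc]
  have hcB : c ∈ B := hc ▸ B.sub_mem hb (h.corner_mem b)
  have hecf : e * c * f = 0 := by
    rw [hc, mul_sub, sub_mul, sub_eq_zero]
    simp only [mul_assoc, h.right_idem, mul_mul_of_mul_eq h.left_idem]
  have h1 : c * f ∈ Ideal.jacobson (⊥ : Ideal A) := by
    by_contra hn
    exact hno (h.exists_larger_left hB hcB hecf hn)
  have h2 : e * c ∈ Ideal.jacobson (⊥ : Ideal A) := by
    by_contra hn
    exact hno (h.exists_larger_right hB hcB hecf hn)
  have h3 : (1 - e - f) * c * (1 - e - f) ∈ Ideal.jacobson (⊥ : Ideal A) := by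
    by_contra hn
    exact hno (h.exists_larger_both hB hcB hn)
  have h4 : c = c * f + e * c + (1 - e - f) * c * (1 - e - f) := by
    have h5 := h.mul_left_eq_zero hB hcB
    have h6 := h.right_mul_eq_zero hB hcB
    have h7 : (1 - e - f) * c = c - e * c := by rw [sub_mul, sub_mul, h6, one_mul, sub_zero]
    rw [h7, mul_sub, mul_sub, sub_mul c (e * c) e, sub_mul c (e * c) f, mul_assoc e c e, h5, hecf]
    noncomm_ring
  rw [h4]
  exact Ideal.add_mem _ (Ideal.add_mem _ h1 h2) h3

/-- Orthogonal idempotents generating the same two-sided ideal form a strict pair. -/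
theorem IsCornerPair.isStrictPair (h : IsCornerPair I B e f) : IsStrictPair e f := by
  have aux : ∀ c u v : A, (∀ a : A, c * a - a * c ∈ Ideal.jacobson (⊥ : Ideal A)) →
      u ∈ sandwich F v → c * v ∈ Ideal.jacobson (⊥ : Ideal A) →
      c * u ∈ Ideal.jacobson (⊥ : Ideal A) := by
    intro c u v hcen hu hv
    have := mul_mul_mem_of_mem_sandwich hu (radical : Submodule F A) c 1 fun a b => by
      change c * (a * v * b) * 1 ∈ Ideal.jacobson (⊥ : Ideal A)
      have h1 : c * (a * v * b) * 1 = ((c * a - a * c) * v + a * (c * v)) * b := by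
        noncomm_ring
      rw [h1]
      rw [Ideal.jacobson_bot] at *
      exact Ideal.mul_mem_right _ _
        (Ideal.add_mem _ (Ideal.mul_mem_right _ _ (Ideal.jacobson_bot (R := A) ▸ hcen a))
          (Ideal.mul_mem_left _ _ hv))
    rwa [mul_one] at this
  refine ⟨h.left_idem, h.right_idem, fun c hc => ⟨fun hv => ?_, fun hv => ?_⟩⟩
  · exact aux c f e (fun a => hc.1.2.1 a trivial) h.right_sandwich hv
  · exact aux c e f (fun a => hc.1.2.1 a trivial) h.left_sandwich hv

theorem IsJordanLie.isJordanClosed (h2 : (2 : F) ≠ 0)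
    (hI : ∀ a : A, ∀ x ∈ I, a * x ∈ I ∧ x * a ∈ I)
    (h : IsJordanLie (Submodule.span F {z : A | ∃ a ∈ I, ∃ b ∈ I, z = ⁅a, b⁆}) B) :
    IsJordanClosed I B := by
  have triple : ∀ b ∈ B, ∀ b' ∈ B, ∀ x ∈ I, ∀ y ∈ I,
      b * (x * y - y * x) * b' + b' * (x * y - y * x) * b ∈ B := by
    intro b hb b' hb' x hx y hy
    have h1 := B.neg_mem (h.1.2 b hb b' hb' ⁅x, y⁆ (Submodule.subset_span ⟨x, hx, y, hy, rfl⟩))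
    convert h1 using 1
    have h3 := h.2 b hb b' hb'
    have h4 := h.2 b' hb' b hb
    obtain ⟨w, hw⟩ : ∃ w, w = x * y - y * x := ⟨_, rfl⟩
    simp only [Ring.lie_def, ← hw, mul_sub, sub_mul, mul_assoc, h4, mul_mul_of_mul_eq h3]
    simp [add_comm]
  refine ⟨hI, fun b hb => ?_, h.2, triple, fun b hb x hx y hy => ?_⟩
  · refine (Submodule.span_le (p := I)).2 ?_ (h.1.1 hb)
    rintro _ ⟨a, ha, b, hb, rfl⟩
    exact I.sub_mem (hI _ _ hb).1 (hI _ _ ha).1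
  · have h1 := B.smul_mem (2 : F)⁻¹ (triple b hb b hb x hx y hy)
    rwa [← two_smul F, inv_smul_smul₀ h2] at h1

end PeirceCorners

/-- **Theorem.** Let `A` be finite-dimensional over an algebraically closed field of
characteristic `p ≠ 2,3`, let `I` be a two-sided ideal of `A` and let `B` be a
bar-minimal Jordan-Lie inner ideal of the Lie algebra `[I,I]` (bar-minimality w.r.t.
the image modulo `rad A ∩ I`).  Then `B = eAf` for some strict orthogonal idempotent
pair `(e, f)` in `A`. -/
theorem ideal_barMinimal_eq_eAf (F A : Type*) [Field F] [IsAlgClosed F] (p : ℕ)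
    [CharP F p] (hp2 : p ≠ 2) (hp3 : p ≠ 3) [Ring A] [Algebra F A]
    [FiniteDimensional F A]
    (I : Submodule F A) (hI : ∀ a : A, ∀ x ∈ I, a * x ∈ I ∧ x * a ∈ I)
    (L : Submodule F A)
    (hL : L = Submodule.span F {z : A | ∃ a ∈ I, ∃ b ∈ I, z = ⁅a, b⁆})
    (B : Submodule F A) (hJLie : IsJordanLie L B)
    (hmin : ∀ B₀ : Submodule F A, IsInnerIdeal L B₀ → B₀ ≤ B →
      (∀ x ∈ B, ∃ y ∈ B₀, x - y ∈ (radical : Submodule F A) ⊓ I) → B₀ = B) :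
    ∃ e f : A, IsStrictPair e f ∧ e * f = 0 ∧ f * e = 0 ∧
      ∀ b : A, b ∈ B ↔ ∃ x : A, b = e * x * f := by
  have h2 : (2 : F) ≠ 0 := by
    intro h0
    have hdvd : p ∣ 2 := (CharP.cast_eq_zero_iff F p 2).1 (by exact_mod_cast h0)
    rcases (Nat.dvd_prime Nat.prime_two).1 hdvd with h1 | h1
    · exact CharP.char_ne_one F p h1
    · exact hp2 h1
  subst hL
  have hB := hJLie.isJordanClosed h2 hI
  obtain ⟨e, f, h, hrad⟩ := hB.exists_cornerPair
  have hle : corner F e f ≤ B := fun z hz => mem_corner.1 hz ▸ h.corner_mem z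
  have hinner : IsInnerIdeal (Submodule.span F {z : A | ∃ a ∈ I, ∃ b ∈ I, z = ⁅a, b⁆})
      (corner F e f) := by
    refine ⟨hle.trans hJLie.1.1, fun b hb b' hb' x _ => ?_⟩
    have h1 := hB.mul_eq_zero b (hle hb) b' (hle hb')
    have h3 := hB.mul_eq_zero b' (hle hb') b (hle hb)
    have hlie : ⁅b, ⁅b', x⁆⁆ = -(b * x * b' + b' * x * b) := by
      simp only [Ring.lie_def, mul_sub, sub_mul, mul_assoc, h3, mul_mul_of_mul_eq h1]
      simp only [mul_zero, zero_mul, zero_sub, sub_zero, neg_add]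
      abel
    rw [hlie]
    have sandwich_mem : ∀ s ∈ corner F e f, ∀ t ∈ corner F e f, s * x * t ∈ corner F e f := by
      intro s hs t ht
      rw [mem_corner] at hs ht ⊢
      rw [← hs, ← ht]
      simp only [mul_assoc, h.right_idem, mul_mul_of_mul_eq h.left_idem]
    exact Submodule.neg_mem _
      (Submodule.add_mem _ (sandwich_mem b hb b' hb') (sandwich_mem b' hb' b hb))
  have hcorner : ∀ x : A, e * x * f ∈ corner F e f := by
    intro x
    rw [mem_corner]
    simp only [mul_assoc, h.right_idem, mul_mul_of_mul_eq h.left_idem]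
  have heq := hmin (corner F e f) hinner hle fun x hx =>
    ⟨e * x * f, hcorner x, hrad x hx, I.sub_mem (hB.le hx) (hB.le (h.corner_mem x))⟩
  refine ⟨e, f, h.isStrictPair, h.left_right, h.right_left, fun b => ⟨fun hb => ?_, ?_⟩⟩
  · rw [← heq, mem_corner] at hb
    exact ⟨b, hb.symm⟩
  · rintro ⟨x, rfl⟩
    exact h.corner_mem x

end Paper
end

section
/- Let A be a finite-dimensional unital associative algebra over an algebraically closed field F with Jacobson radical R, and let I be a left ideal of A. Then there exists a semisimple subalgebra S of A such that A = S ⊕ R as F-vector spaces and I = (I ∩ S) ⊕ (I ∩ R). -/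
namespace Paper

variable (F A : Type*) [Field F] [Ring A] [Algebra F A]

variable {F A}

/-- A ring homomorphism whose kernel is nil reflects the identity up to a unit. -/
theorem isUnit_of_map_eq_one {S T : Type*} [Ring S] [Ring T] (f : S →+* T)
    (hf : ∀ x ∈ RingHom.ker f, IsNilpotent x) {u : S} (hu : f u = 1) : IsUnit u := by
  have h : IsNilpotent (1 - u) := hf _ (by simp [RingHom.mem_ker, hu])
  simpa using h.isUnit_one_sub

/-- A nilpotent idempotent vanishes. -/
theorem eq_zero_of_isIdempotentElem_of_isNilpotent {S : Type*} [Ring S] {x : S}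
    (hx : IsIdempotentElem x) (hn : IsNilpotent x) : x = 0 := by
  obtain ⟨n, hn⟩ := hn
  rw [← hx.pow_succ_eq n, pow_succ, hn, zero_mul]

/-- An equivalence of idempotents lifts along a surjection with nil kernel, with prescribed
idempotent lifts of the two ends. -/
theorem exists_lift_idempotent_equivalence {S T : Type*} [Ring S] [Ring T] (f : S →+* T)
    (hf : ∀ x ∈ RingHom.ker f, IsNilpotent x) (hs : Function.Surjective f)
    {e e' : S} (he : IsIdempotentElem e) (he' : IsIdempotentElem e') {α β : T}
    (hα₁ : f e' * α = α) (hα₂ : α * f e = α) (hβ₁ : f e * β = β) (hβ₂ : β * f e' = β)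
    (hβα : β * α = f e) (hαβ : α * β = f e') :
    ∃ a b : S, e' * a = a ∧ a * e = a ∧ e * b = b ∧ b * e' = b ∧ b * a = e ∧ a * b = e' ∧
      f a = α ∧ f b = β := by
  obtain ⟨a₀, rfl⟩ := hs α
  obtain ⟨b₀, rfl⟩ := hs β
  set a₁ := e' * a₀ * e with ha₁
  set b := e * b₀ * e' with hb
  have fa₁ : f a₁ = f a₀ := by simp only [ha₁, map_mul, hα₁, hα₂]
  have fb : f b = f b₀ := by simp only [hb, map_mul, hβ₁, hβ₂]
  have e'a₁ : e' * a₁ = a₁ := by simp only [ha₁, ← mul_assoc, he'.eq]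
  have a₁e : a₁ * e = a₁ := by simp only [ha₁, mul_assoc, he.eq]
  have eb : e * b = b := by simp only [hb, ← mul_assoc, he.eq]
  have be' : b * e' = b := by simp only [hb, mul_assoc, he'.eq]
  obtain ⟨u, hu⟩ : IsUnit (1 - (e - b * a₁)) :=
    isUnit_of_map_eq_one f hf (by simp [fa₁, fb, hβα])
  have eu : e * u = b * a₁ := by
    rw [hu, mul_sub, mul_one, mul_sub, he.eq, ← mul_assoc, eb]; abel
  have ue : u * e = b * a₁ := by
    rw [hu, sub_mul, one_mul, sub_mul, he.eq, mul_assoc, a₁e]; abel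
  have fu : f u = 1 := by rw [hu]; simp [fa₁, fb, hβα]
  have fu' : f (↑u⁻¹ : S) = 1 := by
    have h := congrArg f u.mul_inv
    rwa [map_mul, fu, one_mul, map_one] at h
  have hcomm : e * (↑u⁻¹ : S) = ↑u⁻¹ * e := by
    have h : Commute e (u : S) := eu.trans ue.symm
    exact h.units_inv_right
  have ba : b * (a₁ * (↑u⁻¹ : S)) = e := by
    rw [← mul_assoc, ← eu, mul_assoc, u.mul_inv, mul_one]
  have e'a : e' * (a₁ * (↑u⁻¹ : S)) = a₁ * ↑u⁻¹ := by rw [← mul_assoc, e'a₁]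
  have ae : a₁ * (↑u⁻¹ : S) * e = a₁ * ↑u⁻¹ := by rw [mul_assoc, ← hcomm, ← mul_assoc, a₁e]
  have fa : f (a₁ * (↑u⁻¹ : S)) = f a₀ := by rw [map_mul, fu', mul_one, fa₁]
  generalize a₁ * (↑u⁻¹ : S) = a at ba e'a ae fa
  refine ⟨a, b, e'a, ae, eb, be', ba, ?_, fa, fb⟩
  have idem : a * b * (a * b) = a * b := by
    rw [mul_assoc, ← mul_assoc b, ba, eb]
  have h : e' - a * b = 0 := by
    refine eq_zero_of_isIdempotentElem_of_isNilpotent ?_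
      (hf _ (by simp [RingHom.mem_ker, fa, fb, hαβ]))
    rw [IsIdempotentElem, sub_mul, mul_sub, mul_sub, he'.eq, idem, mul_assoc a, be',
      ← mul_assoc e', e'a]
    abel
  exact (sub_eq_zero.mp h).symm

/-- A surjection with nil kernel onto a finite product of matrix algebras splits. -/
theorem exists_rightInverse_pi_matrix {K S ι : Type*} [Field K] [Ring S] [Algebra K S]
    [Fintype ι] [DecidableEq ι] (d : ι → ℕ) [∀ i, NeZero (d i)]
    (f : S →ₐ[K] Π i, Matrix (Fin (d i)) (Fin (d i)) K)
    (hf : ∀ x ∈ RingHom.ker f.toRingHom, IsNilpotent x) (hs : Function.Surjective f) :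
    ∃ g : (Π i, Matrix (Fin (d i)) (Fin (d i)) K) →ₐ[K] S, ∀ M, f (g M) = M := by
  let E (i : ι) (j k : Fin (d i)) : Π i, Matrix (Fin (d i)) (Fin (d i)) K :=
    Pi.single i (Matrix.single j k 1)
  have E_mul (i : ι) (j k l : Fin (d i)) : E i j k * E i k l = E i j l := by
    simp [E, ← Pi.single_mul]
  have E_sum (M : Π i, Matrix (Fin (d i)) (Fin (d i)) K) :
      ∑ i, ∑ j, ∑ k, M i j k • E i j k = M := by
    have h (i : ι) : ∑ j, ∑ k, M i j k • E i j k = Pi.single i (M i) := by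
      conv_rhs => rw [Matrix.matrix_eq_sum_single (M i)]
      simp only [E, ← Pi.single_smul, Matrix.smul_single, smul_eq_mul, mul_one]
      simp only [← LinearMap.single_apply (R := K)
        (φ := fun i => Matrix (Fin (d i)) (Fin (d i)) K), map_sum]
    simp only [h]
    exact Finset.univ_sum_single M
  have hE : CompleteOrthogonalIdempotents (fun p : Σ i, Fin (d i) => E p.1 p.2 p.2) := by
    refine ⟨⟨fun p => E_mul _ _ _ _, ?_⟩, ?_⟩
    · rintro ⟨i, j⟩ ⟨i', j'⟩ hne
      by_cases h : i = i'
      · subst h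
        have hj : j ≠ j' := fun h => hne (by rw [h])
        simp [E, ← Pi.single_mul, hj]
      · funext l
        by_cases hl : l = i
        · subst hl
          simp [E, h]
        · simp [E, hl]
    · rw [Fintype.sum_sigma]
      conv_rhs => rw [← E_sum 1]
      simp [Matrix.one_apply]
  obtain ⟨e, he, hfe⟩ := CompleteOrthogonalIdempotents.lift_of_isNilpotent_ker f.toRingHom hf hE
    (fun p => hs _)
  have hfe (i : ι) (j : Fin (d i)) : f.toRingHom (e ⟨i, j⟩) = E i j j := congrFun hfe ⟨i, j⟩
  have key (i : ι) (j : Fin (d i)) := exists_lift_idempotent_equivalence f.toRingHom hf hs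
    (he.idem ⟨i, 0⟩) (he.idem ⟨i, j⟩) (α := E i j 0) (β := E i 0 j)
    (by rw [hfe, E_mul]) (by rw [hfe, E_mul]) (by rw [hfe, E_mul]) (by rw [hfe, E_mul])
    (by rw [hfe, E_mul]) (by rw [hfe, E_mul])
  choose a b ea ae eb be ba ab fa fb using key
  have bab (i : ι) (j k l : Fin (d i)) :
      a i j * b i k * (a i k * b i l) = a i j * b i l := by
    rw [mul_assoc, ← mul_assoc (b i k), ba, ← mul_assoc, ae]
  have orth (p q : Σ i, Fin (d i)) (h : p ≠ q) : b p.1 p.2 * a q.1 q.2 = 0 := by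
    rw [← be, ← ea, mul_assoc, ← mul_assoc (e _), he.ortho h, zero_mul, mul_zero]
  let g₀ : (Π i, Matrix (Fin (d i)) (Fin (d i)) K) →ₗ[K] S :=
    { toFun := fun M => ∑ i, ∑ j, ∑ k, M i j k • (a i j * b i k)
      map_add' := by
        intro M N
        simp [add_smul, Finset.sum_add_distrib]
      map_smul' := by
        intro c M
        simp [mul_smul, Finset.smul_sum] }
  have hg₀ (M) : g₀ M = ∑ i, ∑ j, ∑ k, M i j k • (a i j * b i k) := rfl
  have g_one : g₀ 1 = 1 := by
    rw [hg₀, ← he.complete, Fintype.sum_sigma]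
    simp [Matrix.one_apply, ab]
  have g_mul (M N) : g₀ (M * N) = g₀ M * g₀ N := by
    have cross (i : ι) (j k : Fin (d i)) :
        (a i j * b i k) * g₀ N = ∑ l, N i k l • (a i j * b i l) := by
      rw [hg₀, Finset.mul_sum, Finset.sum_eq_single i, Finset.mul_sum, Finset.sum_eq_single k,
        Finset.mul_sum]
      · simp only [mul_smul_comm, bab]
      · intro k' _ hk
        rw [Finset.mul_sum]
        refine Finset.sum_eq_zero fun l _ => ?_
        have h := orth ⟨i, k⟩ ⟨i, k'⟩ (fun h => hk (by simpa using h.symm))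
        rw [mul_smul_comm, mul_assoc, ← mul_assoc (b i k), h, zero_mul, mul_zero, smul_zero]
      · simp
      · intro i' _ hi
        rw [Finset.mul_sum]
        refine Finset.sum_eq_zero fun k' _ => ?_
        rw [Finset.mul_sum]
        refine Finset.sum_eq_zero fun l _ => ?_
        have h := orth ⟨i, k⟩ ⟨i', k'⟩ (fun h => hi (congrArg Sigma.fst h).symm)
        rw [mul_smul_comm, mul_assoc, ← mul_assoc (b i k), h, zero_mul, mul_zero, smul_zero]
      · simp
    rw [hg₀ (M * N), hg₀ M]
    simp only [Finset.sum_mul, smul_mul_assoc, cross, Pi.mul_apply, Matrix.mul_apply,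
      Finset.sum_smul, Finset.smul_sum, smul_smul]
    refine Finset.sum_congr rfl fun i _ => Finset.sum_congr rfl fun j _ => Finset.sum_comm
  refine ⟨AlgHom.ofLinearMap g₀ g_one g_mul, fun M => ?_⟩
  have fab (i : ι) (j k : Fin (d i)) : f (a i j * b i k) = E i j k := by
    have ha : f (a i j) = E i j 0 := fa i j
    have hb : f (b i k) = E i 0 k := fb i k
    rw [map_mul, ha, hb, E_mul]
  conv_rhs => rw [← E_sum M]
  rw [AlgHom.ofLinearMap_apply, hg₀]
  simp only [map_sum, map_smul, fab]

/-- A surjection with nil kernel onto a finite-dimensional semisimple algebra over an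
algebraically closed field splits. -/
theorem exists_rightInverse_of_isSemisimpleRing {K S T : Type*} [Field K] [IsAlgClosed K]
    [Ring S] [Algebra K S] [Ring T] [Algebra K T] [FiniteDimensional K T] [IsSemisimpleRing T]
    (f : S →ₐ[K] T) (hf : ∀ x ∈ RingHom.ker f.toRingHom, IsNilpotent x)
    (hs : Function.Surjective f) :
    ∃ g : T →ₐ[K] S, ∀ t, f (g t) = t := by
  obtain ⟨n, d, hd, ⟨φ⟩⟩ := IsSemisimpleRing.exists_algEquiv_pi_matrix_of_isAlgClosed K T
  obtain ⟨g, hg⟩ := exists_rightInverse_pi_matrix d (φ.toAlgHom.comp f)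
    (fun x hx => hf x (by simpa [RingHom.mem_ker] using hx)) (φ.surjective.comp hs)
  exact ⟨g.comp φ.toAlgHom, fun t => φ.injective (hg (φ t))⟩

/-- If a homomorphism `f` onto a semisimple algebra has nil kernel and a right inverse, then every
left ideal is stable under `g' ∘ f` for some right inverse `g'` of `f`. -/
theorem exists_rightInverse_map_mem {K S T : Type*} [Field K] [Ring S] [Algebra K S] [Ring T]
    [Algebra K T] [IsSemisimpleRing T] (f : S →ₐ[K] T)
    (hf : ∀ x ∈ RingHom.ker f.toRingHom, IsNilpotent x) (g : T →ₐ[K] S)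
    (hg : ∀ t, f (g t) = t) (I : Ideal S) :
    ∃ g' : T →ₐ[K] S, (∀ t, f (g' t) = t) ∧ ∀ x ∈ I, g' (f x) ∈ I := by
  have hs : Function.Surjective f := fun t => ⟨g t, hg t⟩
  obtain ⟨ε, hε, hI⟩ := IsSemisimpleRing.ideal_eq_span_idempotent (I.map f)
  obtain ⟨x, hxI, hx⟩ : ∃ x ∈ I, f x = ε :=
    (Ideal.mem_map_iff_of_surjective f hs).mp (hI ▸ Ideal.mem_span_singleton_self ε)
  have fu₀ : f (1 - g ε + g ε * x) = 1 := by simp [hg, hx, hε.eq]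
  obtain ⟨u, hu⟩ := isUnit_of_map_eq_one f.toRingHom hf fu₀
  have fu : f (u : S) = 1 := by rw [hu, fu₀]
  have fu' : f (↑u⁻¹ : S) = 1 := by
    have h := congrArg f u.mul_inv
    rwa [map_mul, fu, one_mul, map_one] at h
  have hge : g ε * g ε = g ε := by rw [← map_mul, hε.eq]
  have gu : g ε * u = g ε * x := by
    rw [hu, mul_add, mul_sub, mul_one, ← mul_assoc, hge, sub_self, zero_add]
  let g' : T →ₐ[K] S := AlgHom.ofLinearMap
    (LinearMap.mulLeft K (↑u⁻¹ : S) ∘ₗ LinearMap.mulRight K (u : S) ∘ₗ g.toLinearMap)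
    (by simp) (fun s t => by simp [mul_assoc])
  have hg' (t : T) : g' t = ↑u⁻¹ * (g t * u) := rfl
  refine ⟨g', fun t => by simp [hg', hg, fu, fu'], fun y hy => ?_⟩
  obtain ⟨t, ht⟩ := Ideal.mem_span_singleton'.mp (hI ▸ Ideal.mem_map_of_mem f hy)
  rw [← ht, map_mul, hg' ε, gu, ← mul_assoc, ← mul_assoc]
  exact I.mul_mem_left _ hxI

/-- **Theorem (Wedderburn–Malcev splitting of a left ideal).** Let `A` be a
finite-dimensional unital associative algebra over an algebraically closed field `F`
with radical `R` and let `I` be a left ideal of `A`.  Then there is a semisimple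
subalgebra `S` of `A` with `A = S ⊕ R` and `I = (I ∩ S) ⊕ (I ∩ R)`. -/
theorem left_ideal_splits (F A : Type*) [Field F] [IsAlgClosed F] [Ring A]
    [Algebra F A] [FiniteDimensional F A] (I : Ideal A) :
    ∃ S : Subalgebra F A, IsSemisimpleRing S ∧
      Subalgebra.toSubmodule S ⊓ (radical : Submodule F A) = ⊥ ∧
      Subalgebra.toSubmodule S ⊔ (radical : Submodule F A) = ⊤ ∧
      I.restrictScalars F =
        (I.restrictScalars F ⊓ Subalgebra.toSubmodule S) ⊔
        (I.restrictScalars F ⊓ (radical : Submodule F A)) := by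
  have : IsArtinianRing A := IsArtinianRing.of_finite F A
  let f : A →ₐ[F] A ⧸ Ring.jacobson A := Ideal.Quotient.mkₐ F (Ring.jacobson A)
  have ker_f (x : A) : f x = 0 ↔ x ∈ Ring.jacobson A := Ideal.Quotient.eq_zero_iff_mem
  have hf (x : A) (hx : x ∈ RingHom.ker f.toRingHom) : IsNilpotent x := by
    obtain ⟨n, hn⟩ := IsSemiprimaryRing.isNilpotent (R := A)
    exact ⟨n, by simpa [hn] using Ideal.pow_mem_pow ((ker_f x).mp hx) n⟩
  have hs : Function.Surjective f := Ideal.Quotient.mk_surjective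
  have : FiniteDimensional F (A ⧸ Ring.jacobson A) := .of_surjective f.toLinearMap hs
  obtain ⟨g₀, hg₀⟩ := exists_rightInverse_of_isSemisimpleRing f hf hs
  obtain ⟨g, hg, hgI⟩ := exists_rightInverse_map_mem f hf g₀ hg₀ I
  have mem_rad (x : A) : x ∈ (radical : Submodule F A) ↔ f x = 0 := by
    rw [ker_f, ← Ideal.jacobson_bot]
    rfl
  have sub_mem (x : A) : x - g (f x) ∈ (radical : Submodule F A) := by
    rw [mem_rad, map_sub, hg, sub_self]
  have range_mem (x : A) : g (f x) ∈ Subalgebra.toSubmodule g.range := ⟨f x, rfl⟩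
  refine ⟨g.range, ?_, ?_, ?_, le_antisymm ?_ (sup_le inf_le_left inf_le_left)⟩
  · exact (AlgEquiv.ofInjective g (Function.LeftInverse.injective hg)).toRingEquiv.isSemisimpleRing
  · rw [eq_bot_iff]
    rintro x ⟨⟨t, rfl⟩, hx⟩
    have ht : t = 0 := (hg t).symm.trans ((mem_rad _).mp hx)
    simp [ht]
  · rw [eq_top_iff]
    exact fun x _ => Submodule.mem_sup.mpr ⟨_, range_mem x, _, sub_mem x, by abel⟩
  · intro x hx
    exact Submodule.mem_sup.mpr ⟨_, ⟨hgI x hx, range_mem x⟩, _,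
      ⟨I.sub_mem hx (hgI x hx), sub_mem x⟩, by abel⟩

end Paper
end
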